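/- Let p = (p0,p1,p2) ∈ [0,1)³ be self-dual (κ_△(p) = 0). Then for every α > 0 and every even N ∈ 2ℕ, P^□_{(p0, 1−p0)}[C_v((α + 1/2)N, N/2)] ≥ P^△_p[C_v(αN, N)]. -/

import Mathlib

open MeasureTheory Set

set_option linter.unusedVariables false

namespace Perc

/-- Points of the plane. -/
abbrev Pt := ℝ × ℝ

/-- A lattice embedded in the plane, with edges indexed by `E`;
each edge is embedded as the segment between the two endpoints given by `ends`. -/
structure LatticeOn (E : Type) where
  ends : E → Pt × Pt

/-- Bond configurations. -/
abbrev Config (E : Type) := E → Bool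

/-- `P` is the Bernoulli bond-percolation product measure in which edge `e`
is open with probability `p e`, independently over edges. -/
def IsBernoulliProduct {E : Type} (p : E → ℝ) (P : Measure (Config E)) : Prop :=
  IsProbabilityMeasure P ∧
    ∀ (s : Finset E) (f : E → Bool),
      P {ω | ∀ e ∈ s, ω e = f e} =
        ∏ e ∈ s, ENNReal.ofReal (if f e then p e else 1 - p e)

/-- The union of the closed segments of the open edges. -/
def openEdgeSet {E : Type} (L : LatticeOn E) (ω : Config E) : Set Pt :=
  ⋃ e ∈ {e : E | ω e = true}, segment ℝ (L.ends e).1 (L.ends e).2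

/-- There is an arc, contained in `S` and in the union of the open edges,
with one endpoint in `A` and the other in `B`. -/
def CrossingIn {E : Type} (L : LatticeOn E) (ω : Config E) (S A B : Set Pt) : Prop :=
  ∃ γ : ℝ → Pt, ContinuousOn γ (Icc 0 1) ∧ γ 0 ∈ A ∧ γ 1 ∈ B ∧
    ∀ t ∈ Icc (0:ℝ) 1, γ t ∈ S ∩ openEdgeSet L ω

/-- Rotation of the plane by angle `θ`. -/
noncomputable def rot (θ : ℝ) (z : Pt) : Pt :=
  (Real.cos θ * z.1 - Real.sin θ * z.2, Real.sin θ * z.1 + Real.cos θ * z.2)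

/-- `f` comprises a rotation and a translation. -/
def IsRotTrans (f : Pt → Pt) : Prop := ∃ θ : ℝ, ∃ t : Pt, f = fun z => rot θ z + t

def stdRect (h l : ℝ) : Set Pt := {z | 0 ≤ z.1 ∧ z.1 ≤ h ∧ 0 ≤ z.2 ∧ z.2 ≤ l}
def leftSide (h l : ℝ) : Set Pt := {z | z.1 = 0 ∧ 0 ≤ z.2 ∧ z.2 ≤ l}
def rightSide (h l : ℝ) : Set Pt := {z | z.1 = h ∧ 0 ≤ z.2 ∧ z.2 ≤ l}
def bottomSide (h l : ℝ) : Set Pt := {z | z.2 = 0 ∧ 0 ≤ z.1 ∧ z.1 ≤ h}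
def topSide (h l : ℝ) : Set Pt := {z | z.2 = l ∧ 0 ≤ z.1 ∧ z.1 ≤ h}

/-- The box `f(stdRect h l)` (where `f` is a rotation plus translation) possesses
open crossings in both directions. -/
def HasBoxCrossings {E : Type} (L : LatticeOn E) (ω : Config E) (h l : ℝ) (f : Pt → Pt) : Prop :=
  CrossingIn L ω (f '' stdRect h l) (f '' leftSide h l) (f '' rightSide h l) ∧
  CrossingIn L ω (f '' stdRect h l) (f '' bottomSide h l) (f '' topSide h l)

/-- The box-crossing property: for every `α > 0` there is `δ > 0` such that every box
of size `αN × N` (any position and orientation) possesses open crossings with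
probability at least `δ`, for all large `N`. -/
def BoxCrossingProperty {E : Type} (L : LatticeOn E) (P : Measure (Config E)) : Prop :=
  ∀ α : ℝ, 0 < α → ∃ δ : ℝ, 0 < δ ∧ ∃ N₀ : ℕ, ∀ N : ℕ, N₀ ≤ N →
    ∀ f : Pt → Pt, IsRotTrans f →
      ENNReal.ofReal δ ≤ P {ω | HasBoxCrossings L ω (α * N) N f}

/-- Horizontal-crossing event of the box `[-m,m] × [0,n]`. -/
def Ch {E : Type} (L : LatticeOn E) (m n : ℝ) (ω : Config E) : Prop :=
  CrossingIn L ω {z | -m ≤ z.1 ∧ z.1 ≤ m ∧ 0 ≤ z.2 ∧ z.2 ≤ n}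
    {z | z.1 = -m ∧ 0 ≤ z.2 ∧ z.2 ≤ n} {z | z.1 = m ∧ 0 ≤ z.2 ∧ z.2 ≤ n}

/-- Vertical-crossing event of the box `[-m,m] × [0,n]`. -/
def Cv {E : Type} (L : LatticeOn E) (m n : ℝ) (ω : Config E) : Prop :=
  CrossingIn L ω {z | -m ≤ z.1 ∧ z.1 ≤ m ∧ 0 ≤ z.2 ∧ z.2 ≤ n}
    {z | z.2 = 0 ∧ -m ≤ z.1 ∧ z.1 ≤ m} {z | z.2 = n ∧ -m ≤ z.1 ∧ z.1 ≤ m}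

/-- `u` and `v` are the endpoints of some open edge. -/
def openAdj {E : Type} (L : LatticeOn E) (ω : Config E) (u v : Pt) : Prop :=
  ∃ e, ω e = true ∧ (L.ends e = (u, v) ∨ L.ends e = (v, u))

/-- `u` and `v` are joined by a path of open edges. -/
def openConn {E : Type} (L : LatticeOn E) (ω : Config E) : Pt → Pt → Prop :=
  Relation.ReflTransGen (openAdj L ω)

/-- The open cluster at `v`. -/
def cluster {E : Type} (L : LatticeOn E) (ω : Config E) (v : Pt) : Set Pt :=
  {u | openConn L ω v u}

/-- The vertex set of the lattice. -/
def vertexSet {E : Type} (L : LatticeOn E) : Set Pt :=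
  ⋃ e : E, {(L.ends e).1, (L.ends e).2}

/-- `v` is the endpoint of an infinite open self-avoiding path. -/
def ConnToInfinity {E : Type} (L : LatticeOn E) (ω : Config E) (v : Pt) : Prop :=
  ∃ γ : ℕ → Pt, γ 0 = v ∧ Function.Injective γ ∧ ∀ n, openAdj L ω (γ n) (γ (n + 1))

/-- Euclidean distance on the plane. -/
noncomputable def edist2 (u v : Pt) : ℝ := Real.sqrt ((u.1 - v.1) ^ 2 + (u.2 - v.2) ^ 2)

/-- `rad (C_v) ≥ r`, where `rad (C_v)` is the supremum of all `x` such that `C_v`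
meets the complement of the open Euclidean ball `v + S_x`. -/
def RadiusGE {E : Type} (L : LatticeOn E) (ω : Config E) (v : Pt) (r : ℝ) : Prop :=
  ∀ x : ℝ, x < r → ∃ u ∈ cluster L ω v, x ≤ edist2 v u

/-- `κ_□`. -/
def kappaS (a b : ℝ) : ℝ := a + b - 1
/-- `κ_△`. -/
def kappaT (a b c : ℝ) : ℝ := a + b + c - a * b * c - 1
/-- `κ_⬡`. -/
def kappaH (a b c : ℝ) : ℝ := -kappaT (1 - a) (1 - b) (1 - c)

/-- Edges of a square-type lattice: `(a, b, true)` is the `horizontal`-class edge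
at `(a,b)` and `(a, b, false)` the `vertical`-class edge at `(a,b)`. -/
abbrev SqE := ℤ × ℤ × Bool
/-- Edges of the triangular lattice (also indexing the dual hexagonal edges):
`(a, b, i)` with `i = 0` horizontal, `i = 1` the right edge of an upwards pointing
triangle, `i = 2` the left edge of an upwards pointing triangle, in row `b`. -/
abbrev TriE := ℤ × ℤ × Fin 3

/-- The unit square lattice, with vertex set `ℤ²`. -/
noncomputable def sqLattice : LatticeOn SqE :=
  ⟨fun e =>
    if e.2.2 then (((e.1 : ℝ), (e.2.1 : ℝ)), ((e.1 : ℝ) + 1, (e.2.1 : ℝ)))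
    else (((e.1 : ℝ), (e.2.1 : ℝ)), ((e.1 : ℝ), (e.2.1 : ℝ) + 1))⟩

/-- The dual of the unit square lattice (shifted by `(1/2, 1/2)`), with each dual edge
indexed by the primal edge it crosses. -/
noncomputable def sqDualLattice : LatticeOn SqE :=
  ⟨fun e =>
    if e.2.2 then
      (((e.1 : ℝ) + 1 / 2, (e.2.1 : ℝ) - 1 / 2), ((e.1 : ℝ) + 1 / 2, (e.2.1 : ℝ) + 1 / 2))
    else
      (((e.1 : ℝ) - 1 / 2, (e.2.1 : ℝ) + 1 / 2), ((e.1 : ℝ) + 1 / 2, (e.2.1 : ℝ) + 1 / 2))⟩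

/-- Vertices of the triangular lattice (equilateral triangles of side `√3`,
one family of edges horizontal). -/
noncomputable def tv (a b : ℤ) : Pt :=
  (Real.sqrt 3 * ((a : ℝ) + (b : ℝ) / 2), 3 / 2 * (b : ℝ))

/-- The triangular lattice. -/
noncomputable def triLattice : LatticeOn TriE :=
  ⟨fun e =>
    if e.2.2 = 0 then (tv e.1 e.2.1, tv (e.1 + 1) e.2.1)
    else if e.2.2 = 1 then (tv (e.1 + 1) e.2.1, tv e.1 (e.2.1 + 1))
    else (tv e.1 e.2.1, tv e.1 (e.2.1 + 1))⟩

/-- Circumcentre of the upwards pointing triangle with base vertex `tv a b`. -/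
noncomputable def hup (a b : ℤ) : Pt :=
  (Real.sqrt 3 * ((a : ℝ) + ((b : ℝ) + 1) / 2), 3 / 2 * (b : ℝ) + 1 / 2)

/-- Circumcentre of the downwards pointing triangle below the edge `tv a b – tv (a+1) b`. -/
noncomputable def hdown (a b : ℤ) : Pt :=
  (Real.sqrt 3 * ((a : ℝ) + ((b : ℝ) + 1) / 2), 3 / 2 * (b : ℝ) - 1 / 2)

/-- The hexagonal lattice, the planar dual of `triLattice`, with vertices at the
circumcentres of the triangles; each hexagonal edge is indexed by the triangular
edge it crosses. -/
noncomputable def hexLattice : LatticeOn TriE :=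
  ⟨fun e =>
    if e.2.2 = 0 then (hdown e.1 e.2.1, hup e.1 e.2.1)
    else if e.2.2 = 1 then (hup e.1 e.2.1, hdown e.1 (e.2.1 + 1))
    else (hup e.1 e.2.1, hdown (e.1 - 1) (e.2.1 + 1))⟩

/-- The square lattice with horizontal edges of length `√3` and vertical edges of
length `1` (as in the mixed lattices). -/
noncomputable def sqStretch : LatticeOn SqE :=
  ⟨fun e =>
    if e.2.2 then
      ((Real.sqrt 3 * (e.1 : ℝ), (e.2.1 : ℝ)), (Real.sqrt 3 * ((e.1 : ℝ) + 1), (e.2.1 : ℝ)))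
    else ((Real.sqrt 3 * (e.1 : ℝ), (e.2.1 : ℝ)), (Real.sqrt 3 * (e.1 : ℝ), (e.2.1 : ℝ) + 1))⟩

/-- Vertices of the square lattice rotated by `π/4`. -/
noncomputable def rv (a b : ℤ) : Pt :=
  (((a : ℝ) - (b : ℝ)) / Real.sqrt 2, ((a : ℝ) + (b : ℝ)) / Real.sqrt 2)

/-- The square lattice rotated by `π/4`: edges `(a,b,true)` are inclined at angle `π/4`
and edges `(a,b,false)` at angle `3π/4`; the row (height) of such an edge is `a + b`. -/
noncomputable def rsqLattice : LatticeOn SqE :=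
  ⟨fun e =>
    if e.2.2 then (rv e.1 e.2.1, rv (e.1 + 1) e.2.1)
    else (rv e.1 e.2.1, rv e.1 (e.2.1 + 1))⟩

/-- Inhomogeneous intensities on the square lattice: `ph` on horizontal edges,
`pv` on vertical ones. -/
def sqInt (ph pv : ℝ) : SqE → ℝ := fun e => if e.2.2 then ph else pv

/-- Inhomogeneous intensities on the triangular (or hexagonal) lattice:
`p0` on class-0 edges, `p1` on class-1, `p2` on class-2. -/
def triInt (p0 p1 p2 : ℝ) : TriE → ℝ := fun e => ![p0, p1, p2] e.2.2

/-- Highly inhomogeneous intensities on the triangular (or hexagonal) lattice: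
`p` on horizontal-class edges, `q n` on right edges of upwards pointing triangles at
height `n`, `q' n` on left edges of upwards pointing triangles at height `n`. -/
def triHI (p : ℝ) (q q' : ℤ → ℝ) : TriE → ℝ := fun e =>
  if e.2.2 = 0 then p else if e.2.2 = 1 then q e.2.1 else q' e.2.1

/-- Highly inhomogeneous intensities on the rotated square lattice: `q n` on edges
inclined at `π/4` at height `n`, `q' n` on edges inclined at `3π/4` at height `n`. -/
def rsqHI (q q' : ℤ → ℝ) : SqE → ℝ := fun e =>
  if e.2.2 then q (e.1 + e.2.1) else q' (e.1 + e.2.1)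

/-! ### Percolation on finite multigraphs, recorded through connectivity relations -/

/-- An edge of a weighted multigraph: its two endpoints and the probability that it is open. -/
abbrev WEdge (V : Type) := V × V × unitInterval

section Connectivity

variable {V : Type}

/-- The equivalence relation identifying just `u` and `v`. -/
def glue (u v : V) : Setoid V := Relation.EqvGen.setoid fun x y => x = u ∧ y = v

lemma glue_le_iff {u v : V} {s : Setoid V} : glue u v ≤ s ↔ s u v := by
  constructor
  · exact fun h => h (Relation.EqvGen.rel _ _ ⟨rfl, rfl⟩)
  · rintro h
    exact Setoid.eqvGen_le (by rintro x y ⟨rfl, rfl⟩; exact h)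

lemma glue_rel (u v : V) : glue u v u v := glue_le_iff.1 le_rfl

lemma glue_comm (u v : V) : glue u v = glue v u :=
  le_antisymm (glue_le_iff.2 ((glue v u).symm' (glue_rel v u)))
    (glue_le_iff.2 ((glue u v).symm' (glue_rel u v)))

lemma glue_sup_glue (a b c : V) : glue a b ⊔ glue a c = glue a b ⊔ glue b c := by
  have key : ∀ s : Setoid V, s a b → (s a c ↔ s b c) := fun s h =>
    ⟨fun h' => s.trans' (s.symm' h) h', fun h' => s.trans' h h'⟩
  apply le_antisymm
  · exact sup_le le_sup_left (glue_le_iff.2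
      ((key _ (glue_le_iff.1 le_sup_left)).2 (glue_le_iff.1 le_sup_right)))
  · exact sup_le le_sup_left (glue_le_iff.2
      ((key _ (glue_le_iff.1 le_sup_left)).1 (glue_le_iff.1 le_sup_right)))

/-- The connectivity relation generated by a multiset of edges. -/
def gen (r : Multiset (WEdge V)) : Setoid V := (r.map fun e => glue e.1 e.2.1).sup

lemma gen_zero : gen (0 : Multiset (WEdge V)) = ⊥ := by simp [gen]

lemma gen_cons (e : WEdge V) (r : Multiset (WEdge V)) :
    gen (e ::ₘ r) = glue e.1 e.2.1 ⊔ gen r := by simp [gen]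

lemma gen_le_iff {r : Multiset (WEdge V)} {s : Setoid V} :
    gen r ≤ s ↔ ∀ e ∈ r, s e.1 e.2.1 := by
  simp only [gen, Multiset.sup_le, Multiset.mem_map, forall_exists_index, and_imp,
    forall_apply_eq_imp_iff₂, glue_le_iff]

/-- Some vertex of `S` is related to some vertex of `T`. -/
def Linked (S T : Set V) (s : Setoid V) : Prop := ∃ u ∈ S, ∃ v ∈ T, s u v

lemma Linked.mono {S T : Set V} {s s' : Setoid V} (h : s ≤ s') (hs : Linked S T s) :
    Linked S T s' := by
  obtain ⟨u, hu, v, hv, h'⟩ := hs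
  exact ⟨u, hu, v, hv, h h'⟩

open Classical in
/-- The indicator of `Linked S T`. -/
noncomputable def ind (S T : Set V) (s : Setoid V) : ℝ := if Linked S T s then 1 else 0

lemma ind_mono (S T : Set V) : Monotone (ind S T) := by
  intro s s' h
  unfold ind
  split_ifs with h1 h2 <;> norm_num
  exact h2 (h1.mono h)

lemma ind_le_ind {S T S' T' : Set V} {s s' : Setoid V} (h : Linked S T s → Linked S' T' s') :
    ind S T s ≤ ind S' T' s' := by
  unfold ind
  split_ifs with h1 h2 <;> norm_num
  exact h2 (h h1)

/-- `o` is related to no other vertex. -/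
def IsIsolated (o : V) (s : Setoid V) : Prop := ∀ x, s x o → x = o

lemma isIsolated_gen {o : V} {r : Multiset (WEdge V)} (h : ∀ e ∈ r, e.1 ≠ o ∧ e.2.1 ≠ o) :
    IsIsolated o (gen r) := by
  have : gen r ≤ Setoid.ker (fun x => x = o) := gen_le_iff.2 fun e he => by
    simp [Setoid.ker_def, (h e he).1, (h e he).2]
  intro x hx
  have := this hx
  simpa [Setoid.ker_def] using this

lemma IsIsolated.sup_glue {o a b : V} {s : Setoid V} (h : IsIsolated o s) (ha : a ≠ o)
    (hb : b ≠ o) : IsIsolated o (s ⊔ glue a b) := by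
  have : s ⊔ glue a b ≤ Setoid.ker (fun x => x = o) := by
    refine sup_le ?_ (glue_le_iff.2 (by simp [Setoid.ker_def, ha, hb]))
    intro x y hxy
    rw [Setoid.ker_def, eq_iff_iff]
    constructor
    · rintro rfl; exact h _ (s.symm' hxy)
    · rintro rfl; exact h _ hxy
  intro x hx
  have := this hx
  simpa [Setoid.ker_def] using this

/-- Attaching an isolated vertex to the rest of the graph by a single edge does not affect the
connections between the other vertices. -/
lemma ind_sup_glue_of_isIsolated {o a : V} {s : Setoid V} {S T : Set V} (h : IsIsolated o s)
    (ha : a ≠ o) (hS : o ∉ S) (hT : o ∉ T) : ind S T (s ⊔ glue o a) = ind S T s := by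
  classical
  refine le_antisymm (ind_le_ind ?_) (ind_mono S T le_sup_left)
  rintro ⟨u, hu, v, hv, huv⟩
  have hle : s ⊔ glue o a ≤ Setoid.comap (fun x => if x = o then a else x) s := by
    refine sup_le ?_ (glue_le_iff.2 ?_)
    · intro x y hxy
      rw [Setoid.comap_rel]
      by_cases hx : x = o
      · obtain rfl : y = o := h _ (s.symm' (hx ▸ hxy))
        simp [hx]
      · by_cases hy : y = o
        · exact absurd (h x (hy ▸ hxy)) hx
        · simpa [hx, hy] using hxy
    · rw [Setoid.comap_rel]
      simp [ha]
  have h' := hle huv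
  have huo : u ≠ o := fun h => hS (h ▸ hu)
  have hvo : v ≠ o := fun h => hT (h ▸ hv)
  rw [Setoid.comap_rel, if_neg huo, if_neg hvo] at h'
  exact ⟨u, hu, v, hv, h'⟩

/-- Averaging over the state of a single edge. -/
noncomputable def edgeAvg (e : WEdge V) (F : Setoid V → ℝ) : Setoid V → ℝ := fun s =>
  e.2.2 * F (s ⊔ glue e.1 e.2.1) + (1 - e.2.2) * F s

lemma edgeAvg_swap (u v : V) (p : unitInterval) (F : Setoid V → ℝ) :
    edgeAvg (u, v, p) F = edgeAvg (v, u, p) F := by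
  funext s
  simp only [edgeAvg, glue_comm u v]

instance : LeftCommutative (edgeAvg (V := V)) where
  left_comm a b F := by
    funext s
    simp only [edgeAvg]
    rw [sup_right_comm]
    ring

/-- The expectation of `F`, evaluated at the connectivity relation generated by `s` and the open
edges of `m`, when each edge of `m` is independently open with its own probability. -/
noncomputable def expect (m : Multiset (WEdge V)) (F : Setoid V → ℝ) : Setoid V → ℝ :=
  m.foldr edgeAvg F

lemma expect_zero (F : Setoid V → ℝ) : expect 0 F = F := rfl

lemma expect_cons (e : WEdge V) (m : Multiset (WEdge V)) (F : Setoid V → ℝ) :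
    expect (e ::ₘ m) F = edgeAvg e (expect m F) := Multiset.foldr_cons ..

lemma expect_add (m m' : Multiset (WEdge V)) (F : Setoid V → ℝ) :
    expect (m + m') F = expect m (expect m' F) := Multiset.foldr_add ..

lemma expect_singleton (e : WEdge V) (F : Setoid V → ℝ) :
    expect {e} F = edgeAvg e F := by
  rw [← Multiset.cons_zero, expect_cons, expect_zero]

lemma expect_le_of_forall_le (m : Multiset (WEdge V)) {F G : Setoid V → ℝ} (s : Setoid V)
    (h : ∀ r ≤ m, F (s ⊔ gen r) ≤ G (s ⊔ gen r)) : expect m F s ≤ expect m G s := by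
  induction m using Multiset.induction generalizing s with
  | empty => simpa [gen_zero, expect_zero] using h 0 le_rfl
  | cons e m ih =>
    rw [expect_cons, expect_cons]
    have h1 := ih (s ⊔ glue e.1 e.2.1) fun r hr => by
      have := h (e ::ₘ r) (Multiset.cons_le_cons e hr)
      rwa [gen_cons, ← sup_assoc] at this
    have h2 := ih s fun r hr => h r (hr.trans (Multiset.le_cons_self m e))
    have := e.2.2.2.1
    have := e.2.2.2.2
    unfold edgeAvg
    gcongr

lemma expect_congr (m : Multiset (WEdge V)) {F G : Setoid V → ℝ} (s : Setoid V)
    (h : ∀ r ≤ m, F (s ⊔ gen r) = G (s ⊔ gen r)) : expect m F s = expect m G s :=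
  le_antisymm (expect_le_of_forall_le m s fun r hr => (h r hr).le)
    (expect_le_of_forall_le m s fun r hr => (h r hr).ge)

lemma expect_const (m : Multiset (WEdge V)) (k : ℝ) (s : Setoid V) :
    expect m (fun _ => k) s = k := by
  induction m using Multiset.induction generalizing s with
  | empty => rfl
  | cons e m ih => rw [expect_cons, edgeAvg, ih, ih]; ring

lemma le_expect (m : Multiset (WEdge V)) {F : Setoid V → ℝ} (hF : Monotone F) (s : Setoid V) :
    F s ≤ expect m F s := by
  conv_lhs => rw [← expect_const m (F s) s]
  exact expect_le_of_forall_le m s fun r _ => hF le_sup_left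

lemma expect_le_expect_add (m m' : Multiset (WEdge V)) {F : Setoid V → ℝ} (hF : Monotone F)
    (s : Setoid V) : expect m F s ≤ expect (m + m') F s := by
  rw [expect_add]
  exact expect_le_of_forall_le m s fun r _ => le_expect m' hF _

lemma expect_le_expect_of_le {m m' : Multiset (WEdge V)} (h : m ≤ m') {F : Setoid V → ℝ}
    (hF : Monotone F) (s : Setoid V) : expect m F s ≤ expect m' F s := by
  obtain ⟨k, rfl⟩ := Multiset.le_iff_exists_add.1 h
  exact expect_le_expect_add m k hF s

lemma expect_ind_nonneg (m : Multiset (WEdge V)) (S T : Set V) (s : Setoid V) :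
    0 ≤ expect m (ind S T) s := by
  refine le_trans ?_ (le_expect m (ind_mono S T) s)
  unfold ind
  split_ifs <;> norm_num

/-- The star–triangle transformation. -/
lemma star_triangle {R : Multiset (WEdge V)} {S T : Set V} {o a b c : V}
    {p0 p1 p2 : unitInterval} (hk : kappaT p0 p1 p2 = 0)
    (hR : ∀ e ∈ R, e.1 ≠ o ∧ e.2.1 ≠ o) (hS : o ∉ S) (hT : o ∉ T)
    (ha : a ≠ o) (hb : b ≠ o) (hc : c ≠ o) :
    expect (R + ({(a, b, p0)} + {(c, a, p1)} + {(c, b, p2)})) (ind S T) ⊥ =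
      expect (R + ({(c, o, unitInterval.symm p0)} + {(o, b, unitInterval.symm p1)} +
        {(o, a, unitInterval.symm p2)})) (ind S T) ⊥ := by
  rw [expect_add R, expect_add R]
  refine expect_congr R _ fun r hr => ?_
  rw [bot_sup_eq]
  have hs : IsIsolated o (gen r) := isIsolated_gen fun e he => hR e (Multiset.mem_of_le hr he)
  generalize gen r = s at hs
  have e0 : ∀ x, x ≠ o → ind S T (s ⊔ glue o x) = ind S T s := fun x hx =>
    ind_sup_glue_of_isIsolated hs hx hS hT
  have e1 : ∀ x y, x ≠ o → y ≠ o →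
      ind S T (s ⊔ glue o x ⊔ glue o y) = ind S T (s ⊔ glue x y) := fun x y hx hy => by
    rw [sup_assoc, glue_sup_glue, sup_comm (glue o x), ← sup_assoc]
    exact ind_sup_glue_of_isIsolated (hs.sup_glue hx hy) hx hS hT
  have e2 : ind S T (s ⊔ glue o c ⊔ glue o b ⊔ glue o a) =
      ind S T (s ⊔ glue c b ⊔ glue c a) := by
    rw [sup_assoc s, glue_sup_glue, ← sup_assoc, sup_right_comm s, sup_assoc (s ⊔ glue c b),
      glue_sup_glue, sup_comm (glue o c), ← sup_assoc]
    exact ind_sup_glue_of_isIsolated ((hs.sup_glue hc hb).sup_glue hc ha) hc hS hT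
  have t1 : s ⊔ glue a b ⊔ glue c a = s ⊔ glue c b ⊔ glue c a := by
    rw [sup_assoc, sup_assoc, sup_comm (glue a b), ← glue_sup_glue, sup_comm (glue c a)]
  have t2 : s ⊔ glue a b ⊔ glue c b = s ⊔ glue c b ⊔ glue c a := by
    rw [sup_assoc, sup_assoc, sup_comm (glue a b), glue_comm a b, ← glue_sup_glue]
  have t3 : s ⊔ glue c a ⊔ glue c b = s ⊔ glue c b ⊔ glue c a := sup_right_comm ..
  have t4 : s ⊔ glue c b ⊔ glue c a ⊔ glue c b = s ⊔ glue c b ⊔ glue c a := by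
    rw [sup_right_comm, sup_assoc s, sup_idem]
  simp only [expect_add, expect_singleton, edgeAvg, e0 _ ha, e0 _ hb, e0 _ hc, e2,
    e1 _ _ hc hb, e1 _ _ hc ha, e1 _ _ hb ha, t1, t2, t3, t4, unitInterval.coe_symm_eq,
    glue_comm b a, glue_comm c o]
  unfold kappaT at hk
  generalize ind S T (s ⊔ glue c b ⊔ glue c a) = x1
  generalize ind S T s = x0
  linear_combination (x1 - x0) * hk

/-- The star–triangle transformation, with the reverse orientation of the edges at two of the
vertices. -/
lemma star_triangle' {R : Multiset (WEdge V)} {S T : Set V} {o a b c : V}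
    {p0 p1 p2 : unitInterval} (hk : kappaT p0 p1 p2 = 0)
    (hR : ∀ e ∈ R, e.1 ≠ o ∧ e.2.1 ≠ o) (hS : o ∉ S) (hT : o ∉ T)
    (ha : a ≠ o) (hb : b ≠ o) (hc : c ≠ o) :
    expect (R + ({(a, b, p0)} + {(b, c, p1)} + {(a, c, p2)})) (ind S T) ⊥ =
      expect (R + ({(o, c, unitInterval.symm p0)} + {(a, o, unitInterval.symm p1)} +
        {(b, o, unitInterval.symm p2)})) (ind S T) ⊥ := by
  have key := star_triangle hk hR hS hT hb ha hc
  simp only [expect_add, expect_singleton] at key ⊢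
  rwa [edgeAvg_swap a b, edgeAvg_swap b c, edgeAvg_swap a c, edgeAvg_swap o c, edgeAvg_swap a o,
    edgeAvg_swap b o]

lemma expect_sum_range_congr {F : Setoid V → ℝ} {f g : ℕ → Multiset (WEdge V)} {o : ℕ → V}
    (hfg : ∀ i R, (∀ e ∈ R, e.1 ≠ o i ∧ e.2.1 ≠ o i) →
      expect (R + f i) F ⊥ = expect (R + g i) F ⊥)
    (hf : ∀ i j, ∀ e ∈ f i, e.1 ≠ o j ∧ e.2.1 ≠ o j)
    (hg : ∀ i j, j < i → ∀ e ∈ g i, e.1 ≠ o j ∧ e.2.1 ≠ o j) (k : ℕ)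
    (R : Multiset (WEdge V)) (hR : ∀ i < k, ∀ e ∈ R, e.1 ≠ o i ∧ e.2.1 ≠ o i) :
    expect (R + ∑ i ∈ Finset.range k, f i) F ⊥ =
      expect (R + ∑ i ∈ Finset.range k, g i) F ⊥ := by
  induction k generalizing R with
  | zero => simp
  | succ k ih =>
    rw [Finset.sum_range_succ, ← add_assoc, hfg, add_right_comm, ih, Finset.sum_range_succ,
      add_right_comm, add_assoc]
    · intro i hi e he
      rcases Multiset.mem_add.1 he with he | he
      · exact hR i (by omega) e he
      · exact hg k i hi e he
    · intro e he
      rcases Multiset.mem_add.1 he with he | he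
      · exact hR k (by omega) e he
      · obtain ⟨i, -, hi⟩ := Multiset.mem_sum.1 he
        exact hf i k e hi

/-- An open edge is less likely than two open edges in series, if so are their probabilities. -/
lemma edge_le_series {R : Multiset (WEdge V)} {S T : Set V} {o a c : V}
    {p q r : unitInterval} (h : (p : ℝ) ≤ q * r) :
    expect (R + {(c, a, p)}) (ind S T) ⊥ ≤
      expect (R + ({(c, o, q)} + {(o, a, r)})) (ind S T) ⊥ := by
  rw [expect_add R, expect_add R]
  refine expect_le_of_forall_le R _ fun r' _ => ?_
  generalize ⊥ ⊔ gen r' = s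
  simp only [expect_add, expect_singleton, edgeAvg, glue_comm c o]
  have m1 : ind S T (s ⊔ glue c a) ≤ ind S T (s ⊔ glue o c ⊔ glue o a) := by
    rw [sup_assoc, glue_sup_glue]
    exact ind_mono S T (sup_le_sup_left le_sup_right s)
  have m2 : ind S T s ≤ ind S T (s ⊔ glue o c) := ind_mono S T le_sup_left
  have m3 : ind S T s ≤ ind S T (s ⊔ glue o a) := ind_mono S T le_sup_left
  have m4 : ind S T s ≤ ind S T (s ⊔ glue c a) := ind_mono S T le_sup_left
  have hq := q.2.1
  have hr := r.2.1
  have hq1 := q.2.2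
  have hr1 := r.2.2
  nlinarith [mul_le_mul_of_nonneg_left m1 (mul_nonneg hq hr),
    mul_nonneg (mul_nonneg hq (sub_nonneg.2 hr1)) (sub_nonneg.2 m2),
    mul_nonneg (mul_nonneg hr (sub_nonneg.2 hq1)) (sub_nonneg.2 m3),
    mul_nonneg (sub_nonneg.2 h) (sub_nonneg.2 m4)]

/-- If `D` separates `L` from the edges of `m'`, then a connection from within `L` to a vertex
outside `L` yields a connection to `D` which does not use the edges of `m'`. -/
lemma expect_le_of_separates {m m' : Multiset (WEdge V)} {L D S T : Set V} (hS : S ⊆ L)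
    (hT : ∀ v ∈ T, v ∉ L) (hm : ∀ e ∈ m, e.1 ∈ L ∪ D ∧ e.2.1 ∈ L ∪ D)
    (hm' : ∀ e ∈ m', e.1 ∉ L ∧ e.2.1 ∉ L) :
    expect (m + m') (ind S T) ⊥ ≤ expect m (ind S D) ⊥ := by
  rw [expect_add]
  refine expect_le_of_forall_le m _ fun r hr => ?_
  rw [bot_sup_eq, ← expect_const m' (ind S D (gen r)) (gen r)]
  refine expect_le_of_forall_le m' _ fun r' hr' => ind_le_ind ?_
  rintro ⟨u, hu, v, hv, huv⟩
  by_contra hcon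
  have hD : ∀ w, gen r u w → w ∉ D := fun w hw hwD => hcon ⟨u, hu, w, hwD, hw⟩
  have hle : gen r ⊔ gen r' ≤ Setoid.ker (fun x => x ∈ L ∧ gen r u x) := by
    refine sup_le (gen_le_iff.2 fun e he => ?_) (gen_le_iff.2 fun e he => ?_)
    · have h1 := hm e (Multiset.mem_of_le hr he)
      have hrel : gen r e.1 e.2.1 := gen_le_iff.1 le_rfl e he
      rw [Setoid.ker_def, eq_iff_iff]
      constructor
      · rintro ⟨-, h⟩
        have := (gen r).trans' h hrel
        exact ⟨h1.2.resolve_right (hD _ this), this⟩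
      · rintro ⟨-, h⟩
        have := (gen r).trans' h ((gen r).symm' hrel)
        exact ⟨h1.1.resolve_right (hD _ this), this⟩
    · have h1 := hm' e (Multiset.mem_of_le hr' he)
      simp [Setoid.ker_def, h1.1, h1.2]
  have := hle huv
  rw [Setoid.ker_def, eq_iff_iff] at this
  exact hT v hv (this.1 ⟨hS hu, (gen r).refl' u⟩).1

end Connectivity

/-! ### Mixed strips made of triangular and square rows -/

/-- A vertex `(t, s, a)` of a mixed strip: the level at which it lies has `t` triangular and `s`
square rows below it, and `a` is its position in that level. -/
abbrev MixV := ℤ × ℤ × ℤ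

namespace Mix

variable (p0 p1 p2 : unitInterval) (a0 : ℤ)

/-- The `i`-th vertex of the level `(t, s)`. -/
def vx (t s : ℤ) (i : ℕ) : MixV := (t, s, a0 + i)

/-- The horizontal edges of the level `(t, s)` with `c` vertices. -/
def horiz (t s : ℤ) (c : ℕ) : Multiset (WEdge MixV) :=
  ∑ i ∈ Finset.range (c - 1), {(vx a0 t s i, vx a0 t s (i + 1), p0)}

/-- The inclined edges of the triangular row above the level `(t, s)` with `c` vertices. -/
def triRow (t s : ℤ) (c : ℕ) : Multiset (WEdge MixV) :=
  ∑ i ∈ Finset.range (c - 1), ({(vx a0 t s (i + 1), vx a0 (t + 1) s i, p1)} +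
    {(vx a0 t s i, vx a0 (t + 1) s i, p2)})

/-- The vertical edges of the square row above the level `(t, s)` with `c` vertices. -/
def sqRow (t s : ℤ) (c : ℕ) : Multiset (WEdge MixV) :=
  ∑ i ∈ Finset.range c, {(vx a0 t s i, vx a0 t (s + 1) i, unitInterval.symm p0)}

/-- The edges strictly below the top level of the mixed strip whose rows are listed, from bottom
to top, by `w` (`true` for triangular), and whose lowest level is `(t, s)`. -/
def below : List Bool → ℤ → ℤ → ℕ → Multiset (WEdge MixV)
  | [], _, _, _ => 0
  | true :: w, t, s, c =>
    horiz p0 a0 t s c + triRow p1 p2 a0 t s c + below w (t + 1) s (c - 1)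
  | false :: w, t, s, c => horiz p0 a0 t s c + sqRow p0 a0 t s c + below w t (s + 1) c

/-- The edges of the mixed strip whose rows are listed, from bottom to top, by `w` (`true` for
triangular), and whose lowest level is `(t, s)` and has `c` vertices. -/
def strip : List Bool → ℤ → ℤ → ℕ → Multiset (WEdge MixV)
  | [], t, s, c => horiz p0 a0 t s c
  | true :: w, t, s, c =>
    horiz p0 a0 t s c + triRow p1 p2 a0 t s c + strip w (t + 1) s (c - 1)
  | false :: w, t, s, c => horiz p0 a0 t s c + sqRow p0 a0 t s c + strip w t (s + 1) c

lemma strip_append (u v : List Bool) (t s : ℤ) (c : ℕ) :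
    strip p0 p1 p2 a0 (u ++ v) t s c = below p0 p1 p2 a0 u t s c +
      strip p0 p1 p2 a0 v (t + u.count true) (s + u.count false) (c - u.count true) := by
  induction u generalizing t s c with
  | nil => simp [below]
  | cons b u ih =>
    cases b
    · simp only [List.cons_append, strip, below, ih, add_assoc]
      simp [add_comm, add_left_comm]
    · simp only [List.cons_append, strip, below, ih, add_assoc]
      simp [add_assoc, add_comm, add_left_comm, Nat.sub_sub]

/-- The set of vertices of the level `(t, s)`. -/
def level (t s : ℤ) : Set MixV := {v | v.1 = t ∧ v.2.1 = s}

variable {p0 p1 p2 a0}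

lemma mem_horiz {t s : ℤ} {c : ℕ} {e : WEdge MixV} (h : e ∈ horiz p0 a0 t s c) :
    e.1 ∈ level t s ∧ e.2.1 ∈ level t s := by
  simp only [horiz, Multiset.mem_sum, Multiset.mem_singleton] at h
  obtain ⟨i, -, rfl⟩ := h
  simp [level, vx]

lemma mem_triRow {t s : ℤ} {c : ℕ} {e : WEdge MixV} (h : e ∈ triRow p1 p2 a0 t s c) :
    e.1 ∈ level t s ∧ e.2.1 ∈ level (t + 1) s := by
  simp only [triRow, Multiset.mem_sum, Multiset.mem_add, Multiset.mem_singleton] at h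
  obtain ⟨i, -, rfl | rfl⟩ := h <;> simp [level, vx]

lemma mem_sqRow {t s : ℤ} {c : ℕ} {e : WEdge MixV} (h : e ∈ sqRow p0 a0 t s c) :
    e.1 ∈ level t s ∧ e.2.1 ∈ level t (s + 1) := by
  simp only [sqRow, Multiset.mem_sum, Multiset.mem_singleton] at h
  obtain ⟨i, -, rfl⟩ := h
  simp [level, vx]

lemma mem_strip {w : List Bool} {t s : ℤ} {c : ℕ} {e : WEdge MixV}
    (h : e ∈ strip p0 p1 p2 a0 w t s c) :
    (t ≤ e.1.1 ∧ s ≤ e.1.2.1) ∧ (t ≤ e.2.1.1 ∧ s ≤ e.2.1.2.1) := by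
  induction w generalizing t s c with
  | nil =>
    obtain ⟨⟨h1, h2⟩, h3, h4⟩ := mem_horiz h
    omega
  | cons b w ih =>
    cases b <;> simp only [strip, Multiset.mem_add] at h <;> rcases h with (h | h) | h
    · obtain ⟨⟨h1, h2⟩, h3, h4⟩ := mem_horiz h
      omega
    · obtain ⟨⟨h1, h2⟩, h3, h4⟩ := mem_sqRow h
      omega
    · have := ih h
      omega
    · obtain ⟨⟨h1, h2⟩, h3, h4⟩ := mem_horiz h
      omega
    · obtain ⟨⟨h1, h2⟩, h3, h4⟩ := mem_triRow h
      omega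
    · have := ih h
      omega

lemma mem_below {w : List Bool} {t s : ℤ} {c : ℕ} {e : WEdge MixV}
    (h : e ∈ below p0 p1 p2 a0 w t s c) :
    (e.1.1 ≤ t + w.count true ∧ e.1.2.1 ≤ s + w.count false) ∧
      (e.2.1.1 ≤ t + w.count true ∧ e.2.1.2.1 ≤ s + w.count false) := by
  induction w generalizing t s c with
  | nil => simp [below] at h
  | cons b w ih =>
    cases b <;> simp only [below, Multiset.mem_add] at h <;>
      simp only [List.count_cons_self, Nat.cast_add, Nat.cast_one, ne_eq, reduceCtorEq,
        not_false_eq_true, List.count_cons_of_ne] <;> rcases h with (h | h) | h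
    · obtain ⟨⟨h1, h2⟩, h3, h4⟩ := mem_horiz h
      omega
    · obtain ⟨⟨h1, h2⟩, h3, h4⟩ := mem_sqRow h
      omega
    · have := ih h
      omega
    · obtain ⟨⟨h1, h2⟩, h3, h4⟩ := mem_horiz h
      omega
    · obtain ⟨⟨h1, h2⟩, h3, h4⟩ := mem_triRow h
      omega
    · have := ih h
      omega

lemma mem_strip_of_mem_below {w : List Bool} {t s : ℤ} {c : ℕ} {e : WEdge MixV}
    (h : e ∈ below p0 p1 p2 a0 w t s c) : e ∈ strip p0 p1 p2 a0 w t s c := by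
  rw [← List.append_nil w, strip_append]
  exact Multiset.mem_add.2 (Or.inl h)

variable (p0 p1 p2 a0) in
/-- The two rows meeting at an exchanged level, when the triangular row is the lower one. -/
def triSq (t s : ℤ) (c : ℕ) : Multiset (WEdge MixV) :=
  triRow p1 p2 a0 t s c + horiz p0 a0 (t + 1) s (c - 1) + sqRow p0 a0 (t + 1) s (c - 1)

variable (p0 p1 p2 a0) in
/-- The two rows meeting at an exchanged level, when the square row is the lower one. -/
def sqTri (t s : ℤ) (c : ℕ) : Multiset (WEdge MixV) :=
  sqRow p0 a0 t s c + horiz p0 a0 t (s + 1) c + triRow p1 p2 a0 t (s + 1) c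

variable (p0 p1 p2 a0) in
/-- The stars obtained from the downwards pointing triangles of `triSq` and from the upwards
pointing triangles of `sqTri`: each vertex of the level `(t, s + 1)` is joined to the vertices
of the level `(t + 1, s)` next to it. -/
def zigzag (t s : ℤ) (c : ℕ) : Multiset (WEdge MixV) :=
  ∑ i ∈ Finset.range (c - 1),
    ({(vx a0 t (s + 1) i, vx a0 (t + 1) s i, unitInterval.symm p1)} +
      {(vx a0 t (s + 1) (i + 1), vx a0 (t + 1) s i, unitInterval.symm p2)})

lemma mem_zigzag {t s : ℤ} {c : ℕ} {e : WEdge MixV} (h : e ∈ zigzag p1 p2 a0 t s c) :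
    e.1 ∈ level t (s + 1) ∧ e.2.1 ∈ level (t + 1) s := by
  simp only [zigzag, Multiset.mem_sum, Multiset.mem_add, Multiset.mem_singleton] at h
  obtain ⟨i, -, rfl | rfl⟩ := h <;> simp [level, vx]

lemma le_symm_mul_symm (hk : kappaT p0 p1 p2 = 0) :
    (p2 : ℝ) ≤ unitInterval.symm p0 * unitInterval.symm p1 := by
  unfold kappaT at hk
  rw [unitInterval.coe_symm_eq, unitInterval.coe_symm_eq]
  nlinarith [mul_nonneg (mul_nonneg p0.2.1 p1.2.1) (sub_nonneg.2 p2.2.2)]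

/-- Replacing downwards pointing triangles by stars. -/
lemma expect_triSq_le {t s : ℤ} {c : ℕ} {R : Multiset (WEdge MixV)} {S T : Set MixV}
    (hk : kappaT p0 p1 p2 = 0)
    (hR : ∀ e ∈ R, e.1 ∉ level t (s + 1) ∧ e.2.1 ∉ level t (s + 1))
    (hS : Disjoint S (level t (s + 1))) (hT : Disjoint T (level t (s + 1))) :
    expect (R + triSq p0 p1 p2 a0 t s c) (ind S T) ⊥ ≤
      expect (R + (sqRow p0 a0 t s c + zigzag p1 p2 a0 t s c + sqRow p0 a0 (t + 1) s (c - 1)))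
        (ind S T) ⊥ := by
  rcases c with _ | _ | k
  · simp [triSq, zigzag, triRow, horiz, sqRow]
  · simp only [triSq, zigzag, triRow, horiz, sqRow, zero_add, Nat.sub_self, Nat.zero_sub,
      Finset.range_zero,
      Finset.sum_empty, add_zero]
    exact expect_le_expect_add R _ (ind_mono S T) ⊥
  · set A := vx a0 (t + 1) s with hA
    set C := vx a0 t s with hC
    set O := vx a0 t (s + 1) with hO
    set B := ∑ i ∈ Finset.range (k + 1),
      ({(A i, vx a0 (t + 1) (s + 1) i, unitInterval.symm p0)} : Multiset (WEdge MixV)) with hB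
    have hOl : ∀ i, O i ∈ level t (s + 1) := fun i => ⟨rfl, rfl⟩
    have h1 : R + triSq p0 p1 p2 a0 t s (k + 2) = R + B + {(C 0, A 0, p2)} +
        {(C (k + 1), A k, p1)} + ∑ i ∈ Finset.range k,
        ({(A i, A (i + 1), p0)} + {(C (i + 1), A i, p1)} + {(C (i + 1), A (i + 1), p2)}) := by
      simp only [triSq, triRow, horiz, sqRow, Nat.add_succ_sub_one, Finset.sum_add_distrib,
        hB, hA, hC]
      rw [Finset.sum_range_succ _ k, Finset.sum_range_succ' _ k]
      ac_rfl
    have h2 : sqRow p0 a0 t s (k + 2) + zigzag p1 p2 a0 t s (k + 2) +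
        sqRow p0 a0 (t + 1) s (k + 2 - 1) = B +
        ({(C 0, O 0, unitInterval.symm p0)} + {(O 0, A 0, unitInterval.symm p1)}) +
        ({(C (k + 1), O (k + 1), unitInterval.symm p0)} +
          {(O (k + 1), A k, unitInterval.symm p2)}) + ∑ i ∈ Finset.range k,
        ({(C (i + 1), O (i + 1), unitInterval.symm p0)} +
          {(O (i + 1), A (i + 1), unitInterval.symm p1)} +
          {(O (i + 1), A i, unitInterval.symm p2)}) := by
      simp only [zigzag, sqRow, Nat.add_succ_sub_one, Finset.sum_add_distrib]
      rw [Finset.sum_range_succ' _ (k + 1), Finset.sum_range_succ _ k,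
        Finset.sum_range_succ' _ k, Finset.sum_range_succ _ k]
      abel
    have hAO : ∀ i j, A i ≠ O j := fun i j h => by simp [hA, hO, vx] at h
    have hCO : ∀ i j, C i ≠ O j := fun i j h => by simp [hC, hO, vx] at h
    rw [h1, h2, expect_sum_range_congr (o := fun i => O (i + 1)) (g := fun i =>
      {(C (i + 1), O (i + 1), unitInterval.symm p0)} +
          {(O (i + 1), A (i + 1), unitInterval.symm p1)} +
          {(O (i + 1), A i, unitInterval.symm p2)})]
    · generalize (Finset.sum (Finset.range k) _ : Multiset (WEdge MixV)) = Z
      calc _ = expect ((R + B + {(C (k + 1), A k, p1)} + Z) + {(C 0, A 0, p2)}) (ind S T) ⊥ := by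
            congr 1; abel_nf
        _ ≤ _ := edge_le_series (o := O 0) (le_symm_mul_symm hk)
        _ = expect ((R + B + ({(C 0, O 0, unitInterval.symm p0)} +
            {(O 0, A 0, unitInterval.symm p1)}) + Z) + {(C (k + 1), A k, p1)}) (ind S T) ⊥ := by
            congr 1; abel_nf
        _ ≤ _ := edge_le_series (o := O (k + 1)) (le_symm_mul_symm (p0 := p0) (p1 := p2) (p2 := p1)
            (by rw [← hk]; unfold kappaT; ring))
        _ = _ := by congr 1; abel_nf
    · intro i R' hR'
      exact star_triangle hk hR' (fun h => hS.le_bot ⟨h, hOl _⟩) (fun h => hT.le_bot ⟨h, hOl _⟩)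
        (hAO _ _) (hAO _ _) (hCO _ _)
    · intro i j e he
      simp only [Multiset.mem_add, Multiset.mem_singleton] at he
      rcases he with (rfl | rfl) | rfl <;> simp [hAO, hCO]
    · intro i j hij e he
      have hOO : O (i + 1) ≠ O (j + 1) := by simp [hO, vx]; omega
      simp only [Multiset.mem_add, Multiset.mem_singleton] at he
      rcases he with (rfl | rfl) | rfl <;> simp [hAO, hCO, hOO]
    · intro i hi e he
      simp only [Multiset.mem_add, Multiset.mem_singleton, hB, Multiset.mem_sum] at he
      rcases he with ((he | ⟨j, -, rfl⟩) | rfl) | rfl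
      · exact ⟨fun h => (hR e he).1 (h ▸ hOl _), fun h => (hR e he).2 (h ▸ hOl _)⟩
      · exact ⟨hAO _ _, fun h => by simp [hO, vx] at h⟩
      · exact ⟨hCO _ _, hAO _ _⟩
      · exact ⟨hCO _ _, hAO _ _⟩

/-- Replacing stars by upwards pointing triangles. -/
lemma expect_sqTri {t s : ℤ} {c : ℕ} {R : Multiset (WEdge MixV)} {S T : Set MixV}
    (hk : kappaT p0 p1 p2 = 0)
    (hR : ∀ e ∈ R, e.1 ∉ level (t + 1) s ∧ e.2.1 ∉ level (t + 1) s)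
    (hS : Disjoint S (level (t + 1) s)) (hT : Disjoint T (level (t + 1) s)) :
    expect (R + (sqRow p0 a0 t s c + zigzag p1 p2 a0 t s c + sqRow p0 a0 (t + 1) s (c - 1)))
        (ind S T) ⊥ = expect (R + sqTri p0 p1 p2 a0 t s c) (ind S T) ⊥ := by
  set A := vx a0 (t + 1) s with hA
  set B := vx a0 (t + 1) (s + 1) with hB
  set O := vx a0 t (s + 1) with hO
  have hAl : ∀ i, A i ∈ level (t + 1) s := fun i => ⟨rfl, rfl⟩
  have h1 : R + (sqRow p0 a0 t s c + zigzag p1 p2 a0 t s c + sqRow p0 a0 (t + 1) s (c - 1)) =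
      R + sqRow p0 a0 t s c + ∑ i ∈ Finset.range (c - 1),
      ({(A i, B i, unitInterval.symm p0)} + {(O i, A i, unitInterval.symm p1)} +
        {(O (i + 1), A i, unitInterval.symm p2)}) := by
    simp only [zigzag, sqRow, Finset.sum_add_distrib]
    abel
  have h2 : R + sqTri p0 p1 p2 a0 t s c = R + sqRow p0 a0 t s c + ∑ i ∈ Finset.range (c - 1),
      ({(O i, O (i + 1), p0)} + {(O (i + 1), B i, p1)} + {(O i, B i, p2)}) := by
    simp only [sqTri, triRow, horiz, sqRow, Finset.sum_add_distrib]
    abel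
  have hOA : ∀ i j, O i ≠ A j := fun i j h => by simp [hA, hO, vx] at h
  have hBA : ∀ i j, B i ≠ A j := fun i j h => by simp [hA, hB, vx] at h
  rw [h1, h2]
  symm
  refine expect_sum_range_congr (o := A) ?_ ?_ ?_ _ _ ?_
  · intro i R' hR'
    exact star_triangle' hk hR' (fun h => hS.le_bot ⟨h, hAl _⟩) (fun h => hT.le_bot ⟨h, hAl _⟩)
      (hOA _ _) (hOA _ _) (hBA _ _)
  · intro i j e he
    simp only [Multiset.mem_add, Multiset.mem_singleton] at he
    rcases he with (rfl | rfl) | rfl <;> simp [hOA, hBA]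
  · intro i j hij e he
    have hAA : A i ≠ A j := by simp [hA, vx]; omega
    simp only [Multiset.mem_add, Multiset.mem_singleton] at he
    rcases he with (rfl | rfl) | rfl <;> simp [hOA, hBA, hAA]
  · intro i hi e he
    rcases Multiset.mem_add.1 he with he | he
    · exact ⟨fun h => (hR e he).1 (h ▸ hAl _), fun h => (hR e he).2 (h ▸ hAl _)⟩
    · obtain ⟨⟨h1, h2⟩, h3, h4⟩ := mem_sqRow he
      constructor
      · intro h; rw [h] at h1; simp [hA, vx] at h1
      · intro h; rw [h] at h3; simp [hA, vx] at h3

section Flip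

variable {t s : ℤ} {c : ℕ} {R R' : Multiset (WEdge MixV)} {S : Set MixV}

/-- Exchanging a triangular row with the square row above it does not decrease the probability of
reaching a given level other than the one between the two rows. -/
lemma expect_triSq_le_expect_sqTri {T : Set MixV} (hk : kappaT p0 p1 p2 = 0)
    (hR : ∀ e ∈ R, (e.1.1 ≤ t ∧ e.1.2.1 ≤ s) ∧ (e.2.1.1 ≤ t ∧ e.2.1.2.1 ≤ s))
    (hR' : ∀ e ∈ R', (t + 1 ≤ e.1.1 ∧ s + 1 ≤ e.1.2.1) ∧
      (t + 1 ≤ e.2.1.1 ∧ s + 1 ≤ e.2.1.2.1))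
    (hS : ∀ v ∈ S, v.1 ≤ t ∧ v.2.1 ≤ s) (hT : Disjoint T (level t (s + 1)))
    (hT' : Disjoint T (level (t + 1) s)) :
    expect (R + R' + triSq p0 p1 p2 a0 t s c) (ind S T) ⊥ ≤
      expect (R + R' + sqTri p0 p1 p2 a0 t s c) (ind S T) ⊥ := by
  rw [← expect_sqTri hk _ _ hT']
  · refine expect_triSq_le hk (fun e he => ?_) ?_ hT
    · simp only [level, mem_ofPred_eq]
      rcases Multiset.mem_add.1 he with he | he
      · have := hR e he
        omega
      · have := hR' e he
        omega
    · refine Set.disjoint_left.2 fun v hv hv' => ?_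
      have := hS v hv
      simp only [level, mem_ofPred_eq] at hv'
      omega
  · intro e he
    simp only [level, mem_ofPred_eq]
    rcases Multiset.mem_add.1 he with he | he
    · have := hR e he
      omega
    · have := hR' e he
      omega
  · refine Set.disjoint_left.2 fun v hv hv' => ?_
    have := hS v hv
    simp only [level, mem_ofPred_eq] at hv'
    omega

/-- Exchanging a triangular row with the square row above it does not decrease the probability of
reaching the level between the two rows. -/
lemma expect_triSq_level_le_expect_sqTri_level (hk : kappaT p0 p1 p2 = 0)
    (hR : ∀ e ∈ R, (e.1.1 ≤ t ∧ e.1.2.1 ≤ s) ∧ (e.2.1.1 ≤ t ∧ e.2.1.2.1 ≤ s))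
    (hR' : ∀ e ∈ R', (t + 1 ≤ e.1.1 ∧ s + 1 ≤ e.1.2.1) ∧
      (t + 1 ≤ e.2.1.1 ∧ s + 1 ≤ e.2.1.2.1))
    (hS : ∀ v ∈ S, v.1 ≤ t ∧ v.2.1 ≤ s) :
    expect (R + R' + triSq p0 p1 p2 a0 t s c) (ind S (level (t + 1) s)) ⊥ ≤
      expect (R + R' + sqTri p0 p1 p2 a0 t s c) (ind S (level t (s + 1))) ⊥ := by
  calc _ ≤ expect (R + R' + (sqRow p0 a0 t s c + zigzag p1 p2 a0 t s c +
        sqRow p0 a0 (t + 1) s (c - 1))) (ind S (level (t + 1) s)) ⊥ := by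
        refine expect_triSq_le hk (fun e he => ?_) ?_ ?_
        · simp only [level, mem_ofPred_eq]
          rcases Multiset.mem_add.1 he with he | he
          · have := hR e he
            omega
          · have := hR' e he
            omega
        · refine Set.disjoint_left.2 fun v hv hv' => ?_
          have := hS v hv
          simp only [level, mem_ofPred_eq] at hv'
          omega
        · refine Set.disjoint_left.2 fun v hv hv' => ?_
          simp only [level, mem_ofPred_eq] at hv hv'
          omega
    _ = expect ((R + sqRow p0 a0 t s c) + (zigzag p1 p2 a0 t s c +
        sqRow p0 a0 (t + 1) s (c - 1) + R')) (ind S (level (t + 1) s)) ⊥ := by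
        congr 1; abel_nf
    _ ≤ expect (R + sqRow p0 a0 t s c) (ind S (level t (s + 1))) ⊥ := by
        refine expect_le_of_separates (L := {v : MixV | v.1 ≤ t ∧ v.2.1 ≤ s}) hS ?_ ?_ ?_
        · intro v hv
          simp only [level, mem_ofPred_eq] at hv ⊢
          omega
        · intro e he
          simp only [level, mem_union, mem_ofPred_eq]
          rcases Multiset.mem_add.1 he with he | he
          · have := hR e he
            omega
          · obtain ⟨⟨h1, h2⟩, h3, h4⟩ := mem_sqRow he
            omega
        · intro e he
          simp only [mem_ofPred_eq]
          rw [Multiset.mem_add, Multiset.mem_add] at he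
          rcases he with (he | he) | he
          · obtain ⟨⟨h1, h2⟩, h3, h4⟩ := mem_zigzag he
            omega
          · obtain ⟨⟨h1, h2⟩, h3, h4⟩ := mem_sqRow he
            omega
          · have := hR' e he
            omega
    _ ≤ _ := by
        refine expect_le_expect_of_le (Multiset.le_iff_exists_add.2
          ⟨horiz p0 a0 t (s + 1) c + triRow p1 p2 a0 t (s + 1) c + R', ?_⟩) (ind_mono _ _) ⊥
        unfold sqTri
        abel

end Flip

variable (p0 p1 p2 a0) in
/-- The probability that, in a mixed strip with rows `w`, the lowest level is connected to the
level above the first `n` rows. -/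
noncomputable def reach (n c : ℕ) (w : List Bool) : ℝ :=
  expect (strip p0 p1 p2 a0 w 0 0 c)
    (ind (level 0 0) (level ((w.take n).count true) ((w.take n).count false))) ⊥

lemma reach_swap_le (hk : kappaT p0 p1 p2 = 0) (n c : ℕ) (u v : List Bool) :
    reach p0 p1 p2 a0 n c (u ++ true :: false :: v) ≤
      reach p0 p1 p2 a0 n c (u ++ false :: true :: v) := by
  obtain ⟨t, ht⟩ : ∃ t : ℤ, t = u.count true := ⟨_, rfl⟩
  obtain ⟨s, hs⟩ : ∃ s : ℤ, s = u.count false := ⟨_, rfl⟩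
  obtain ⟨k, hc⟩ : ∃ k : ℕ, k = c - u.count true := ⟨_, rfl⟩
  have e1 : strip p0 p1 p2 a0 (u ++ true :: false :: v) 0 0 c =
      (below p0 p1 p2 a0 u 0 0 c + horiz p0 a0 t s k) +
        strip p0 p1 p2 a0 v (t + 1) (s + 1) (k - 1) + triSq p0 p1 p2 a0 t s k := by
    rw [strip_append, zero_add, zero_add, ← ht, ← hs, ← hc]
    simp only [strip, triSq]
    abel
  have e2 : strip p0 p1 p2 a0 (u ++ false :: true :: v) 0 0 c =
      (below p0 p1 p2 a0 u 0 0 c + horiz p0 a0 t s k) +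
        strip p0 p1 p2 a0 v (t + 1) (s + 1) (k - 1) + sqTri p0 p1 p2 a0 t s k := by
    rw [strip_append, zero_add, zero_add, ← ht, ← hs, ← hc]
    simp only [strip, sqTri]
    abel
  have hR : ∀ e ∈ below p0 p1 p2 a0 u 0 0 c + horiz p0 a0 t s k,
      (e.1.1 ≤ t ∧ e.1.2.1 ≤ s) ∧ (e.2.1.1 ≤ t ∧ e.2.1.2.1 ≤ s) := by
    intro e he
    rcases Multiset.mem_add.1 he with he | he
    · have := mem_below he
      omega
    · obtain ⟨⟨h1, h2⟩, h3, h4⟩ := mem_horiz he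
      omega
  have hR' : ∀ e ∈ strip p0 p1 p2 a0 v (t + 1) (s + 1) (k - 1),
      (t + 1 ≤ e.1.1 ∧ s + 1 ≤ e.1.2.1) ∧ (t + 1 ≤ e.2.1.1 ∧ s + 1 ≤ e.2.1.2.1) :=
    fun e he => mem_strip he
  have hS : ∀ v ∈ level 0 0, v.1 ≤ t ∧ v.2.1 ≤ s := by
    rintro v ⟨h1, h2⟩
    omega
  unfold reach
  rw [e1, e2]
  rcases lt_trichotomy n (u.length + 1) with h | h | h
  · rw [List.take_append_of_le_length (by omega), List.take_append_of_le_length (by omega)]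
    have c1 := (List.take_sublist n u).count_le true
    have c2 := (List.take_sublist n u).count_le false
    refine expect_triSq_le_expect_sqTri hk hR hR' hS ?_ ?_ <;>
    · refine Set.disjoint_left.2 fun v hv hv' => ?_
      simp only [level, mem_ofPred_eq] at hv hv'
      omega
  · subst h
    have := expect_triSq_level_le_expect_sqTri_level (a0 := a0) (c := k) hk hR hR' hS
    simpa [List.take_length_add_append, List.count_append, ht, hs] using this
  · obtain ⟨j, rfl⟩ : ∃ j, n = u.length + (j + 2) := ⟨n - u.length - 2, by omega⟩
    simp only [List.take_length_add_append, List.take_succ_cons, List.count_append,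
      List.count_cons_self, ne_eq, reduceCtorEq, not_false_eq_true, List.count_cons_of_ne]
    refine expect_triSq_le_expect_sqTri hk hR hR' hS ?_ ?_ <;>
    · refine Set.disjoint_left.2 fun v hv hv' => ?_
      simp only [level, mem_ofPred_eq] at hv hv'
      omega

lemma reach_replicate_append_le (hk : kappaT p0 p1 p2 = 0) (n c k : ℕ) (u v : List Bool) :
    reach p0 p1 p2 a0 n c (u ++ (List.replicate k true ++ false :: v)) ≤
      reach p0 p1 p2 a0 n c (u ++ false :: (List.replicate k true ++ v)) := by
  induction k generalizing v with
  | zero => simp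
  | succ k ih =>
    have h1 := reach_swap_le (a0 := a0) hk n c (u ++ List.replicate k true) v
    have h2 := ih (true :: v)
    simp only [List.replicate_succ', List.append_assoc, List.cons_append, List.nil_append] at *
    exact h1.trans h2

lemma reach_replicate_le (hk : kappaT p0 p1 p2 = 0) (n c k m : ℕ) (u : List Bool) :
    reach p0 p1 p2 a0 n c (u ++ (List.replicate k true ++ List.replicate m false)) ≤
      reach p0 p1 p2 a0 n c (u ++ (List.replicate m false ++ List.replicate k true)) := by
  induction m generalizing u with
  | zero => simp
  | succ m ih =>
    have h1 := reach_replicate_append_le (a0 := a0) hk n c k u (List.replicate m false)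
    have h2 := ih (u ++ [false])
    simp only [List.replicate_succ, List.append_assoc, List.cons_append, List.nil_append] at *
    exact h1.trans h2

/-- A vertical crossing of `n` triangular rows is at most as likely as one of `n` square rows. -/
lemma expect_below_replicate_le (hk : kappaT p0 p1 p2 = 0) {n : ℕ} (hn : 0 < n) (c : ℕ) :
    expect (below p0 p1 p2 a0 (List.replicate n true) 0 0 c) (ind (level 0 0) (level n 0)) ⊥ ≤
      expect (below p0 p1 p2 a0 (List.replicate n false) 0 0 c)
        (ind (level 0 0) (level 0 n)) ⊥ := by
  have h := reach_replicate_le (a0 := a0) hk n c n n []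
  have hT : (List.replicate n true ++ List.replicate n false).take n = List.replicate n true := by
    simp
  have hF : (List.replicate n false ++ List.replicate n true).take n = List.replicate n false := by
    simp
  have c1 : (List.replicate n true).count false = 0 := by simp [List.count_replicate]
  have c2 : (List.replicate n false).count true = 0 := by simp [List.count_replicate]
  rw [List.nil_append, List.nil_append, reach, reach, hT, hF, strip_append, strip_append,
    List.count_replicate_self, List.count_replicate_self, c1, c2, Nat.cast_zero] at h
  refine (expect_le_expect_add _ _ (ind_mono _ _) ⊥).trans (h.trans ?_)
  refine expect_le_of_separates (L := {v : MixV | v.2.1 < n}) ?_ ?_ ?_ ?_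
  · rintro v ⟨-, h2⟩
    simp only [mem_ofPred_eq]
    omega
  · rintro v ⟨-, h2⟩
    simp only [mem_ofPred_eq]
    omega
  · intro e he
    have h1 := mem_below he
    have h2 := mem_strip (mem_strip_of_mem_below he)
    rw [List.count_replicate_self, c2] at h1
    simp only [level, mem_union, mem_ofPred_eq]
    omega
  · intro e he
    have := mem_strip he
    simp only [mem_ofPred_eq]
    omega

end Mix

/-! ### Connections by the open edges of a Bernoulli configuration -/

section Bernoulli

variable {V E : Type} {p : E → ℝ} {P : Measure (Config E)} {lab : E → WEdge V}

/-- The connectivity relation generated by those edges in `K` which are open in `ω`, where the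
edge `e` joins the endpoints of `lab e`. -/
def openGen (lab : E → WEdge V) (K : Finset E) (ω : Config E) : Setoid V :=
  gen ((K.filter fun e => ω e = true).val.map lab)

lemma openGen_le_iff {K : Finset E} {ω : Config E} {s : Setoid V} :
    openGen lab K ω ≤ s ↔ ∀ e ∈ K, ω e = true → s (lab e).1 (lab e).2.1 := by
  rw [openGen, gen_le_iff]
  simp only [Multiset.mem_map, Finset.mem_val, Finset.mem_filter, forall_exists_index, and_imp]
  exact ⟨fun h e he ho => h _ e he ho rfl, by rintro h _ e he ho rfl; exact h e he ho⟩

lemma openGen_insert_of_open [DecidableEq E] {K : Finset E} {ω : Config E} {a : E} (ha : a ∉ K)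
    (h : ω a = true) :
    openGen lab (insert a K) ω = glue (lab a).1 (lab a).2.1 ⊔ openGen lab K ω := by
  unfold openGen
  rw [Finset.filter_insert, if_pos h, Finset.insert_val_of_notMem (by simp [ha]),
    Multiset.map_cons, gen_cons]

lemma openGen_insert_of_closed [DecidableEq E] {K : Finset E} {ω : Config E} {a : E}
    (h : ¬ ω a = true) : openGen lab (insert a K) ω = openGen lab K ω := by
  unfold openGen
  rw [Finset.filter_insert, if_neg h]

lemma cylinder_update [DecidableEq E] {a : E} {D : Finset E} (ha : a ∉ D) (f : E → Bool)
    (b : Bool) : {ω : Config E | ∀ e ∈ insert a D, ω e = Function.update f a b e} =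
      {ω | ∀ e ∈ D, ω e = f e} ∩ {ω | ω a = b} := by
  ext ω
  simp only [Finset.mem_insert, forall_eq_or_imp, Function.update_self, mem_ofPred_eq, mem_inter_iff]
  rw [and_comm]
  refine and_congr_left fun _ => forall₂_congr fun e he => ?_
  rw [Function.update_of_ne (ne_of_mem_of_not_mem he ha)]

lemma measure_cylinder_inter_linked (hP : IsBernoulliProduct p P)
    (hlab : ∀ e, p e = (lab e).2.2) (K D : Finset E) (hKD : Disjoint K D) (f : E → Bool)
    (S T : Set V) (s : Setoid V) :
    P ({ω | ∀ e ∈ D, ω e = f e} ∩ {ω | Linked S T (s ⊔ openGen lab K ω)}) =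
      (∏ e ∈ D, ENNReal.ofReal (if f e then p e else 1 - p e)) *
        ENNReal.ofReal (expect (K.val.map lab) (ind S T) s) := by
  classical
  induction K using Finset.induction_on generalizing D f s with
  | empty =>
    have h0 : ∀ ω : Config E, openGen lab ∅ ω = ⊥ := fun ω => by simp [openGen, gen_zero]
    simp only [h0, sup_bot_eq, Finset.empty_val, Multiset.map_zero, expect_zero, ind]
    by_cases h : Linked S T s
    · simp [h, hP.2]
    · simp [h]
  | insert a K ha ih =>
    rw [Finset.disjoint_insert_left] at hKD
    obtain ⟨haD, hKD⟩ := hKD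
    have hd : Disjoint K (insert a D) := Finset.disjoint_insert_right.2 ⟨ha, hKD⟩
    have hm : MeasurableSet {ω : Config E | ω a = true} :=
      measurableSet_eq_fun (measurable_pi_apply a) measurable_const
    have hprod : ∀ b : Bool, (∏ e ∈ insert a D, ENNReal.ofReal
        (if Function.update f a b e then p e else 1 - p e)) =
        ENNReal.ofReal (if b then p a else 1 - p a) *
          ∏ e ∈ D, ENNReal.ofReal (if f e then p e else 1 - p e) := fun b => by
      rw [Finset.prod_insert haD, Function.update_self]
      congr 1
      refine Finset.prod_congr rfl fun e he => ?_
      rw [Function.update_of_ne (ne_of_mem_of_not_mem he haD)]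
    have h1 := ih (insert a D) hd (Function.update f a true) (s ⊔ glue (lab a).1 (lab a).2.1)
    have h2 := ih (insert a D) hd (Function.update f a false) s
    rw [cylinder_update haD, hprod] at h1 h2
    rw [← measure_inter_add_sdiff _ hm]
    have e1 : {ω : Config E | ∀ e ∈ D, ω e = f e} ∩
        {ω | Linked S T (s ⊔ openGen lab (insert a K) ω)} ∩ {ω | ω a = true} =
        {ω | ∀ e ∈ D, ω e = f e} ∩ {ω | ω a = true} ∩
          {ω | Linked S T (s ⊔ glue (lab a).1 (lab a).2.1 ⊔ openGen lab K ω)} := by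
      ext ω
      simp only [mem_inter_iff, mem_ofPred_eq]
      rw [and_right_comm]
      refine and_congr_right fun h => ?_
      rw [openGen_insert_of_open ha h.2, sup_assoc]
    have e2 : ({ω : Config E | ∀ e ∈ D, ω e = f e} ∩
        {ω | Linked S T (s ⊔ openGen lab (insert a K) ω)}) \ {ω | ω a = true} =
        {ω | ∀ e ∈ D, ω e = f e} ∩ {ω | ω a = false} ∩
          {ω | Linked S T (s ⊔ openGen lab K ω)} := by
      ext ω
      simp only [mem_inter_iff, mem_ofPred_eq, mem_sdiff]
      rw [and_right_comm, Bool.not_eq_true]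
      refine and_congr_right fun h => ?_
      rw [openGen_insert_of_closed (by simp [h.2])]
    rw [e1, e2, h1, h2, Finset.insert_val_of_notMem ha, Multiset.map_cons, expect_cons, edgeAvg,
      ENNReal.ofReal_add, ENNReal.ofReal_mul, ENNReal.ofReal_mul, hlab]
    · simp only [if_true, Bool.false_eq_true, if_false]
      ring
    · exact sub_nonneg.2 (lab a).2.2.2.2
    · exact (lab a).2.2.2.1
    · exact mul_nonneg (lab a).2.2.2.1 (expect_ind_nonneg _ _ _ _)
    · exact mul_nonneg (sub_nonneg.2 (lab a).2.2.2.2) (expect_ind_nonneg _ _ _ _)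

/-- The probability that two sets are connected by open edges. -/
lemma measure_linked_openGen (hP : IsBernoulliProduct p P) (hlab : ∀ e, p e = (lab e).2.2)
    (K : Finset E) (S T : Set V) :
    P {ω | Linked S T (openGen lab K ω)} =
      ENNReal.ofReal (expect (K.val.map lab) (ind S T) ⊥) := by
  simpa using measure_cylinder_inter_linked hP hlab K ∅ (Finset.disjoint_empty_right K)
    (fun _ => true) S T ⊥

end Bernoulli

namespace Mix

variable {p0 p1 p2 : unitInterval} {a0 : ℤ}

/-- The edges of the square lattice, as edges of a mixed strip. -/
def sqLab (p0 : unitInterval) (e : SqE) : WEdge MixV :=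
  if e.2.2 then ((0, e.2.1, e.1), (0, e.2.1, e.1 + 1), p0)
  else ((0, e.2.1, e.1), (0, e.2.1 + 1, e.1), unitInterval.symm p0)

/-- The edges of the triangular lattice, as edges of a mixed strip. -/
def triLab (p0 p1 p2 : unitInterval) (e : TriE) : WEdge MixV :=
  ![((e.2.1, 0, e.1), (e.2.1, 0, e.1 + 1), p0), ((e.2.1, 0, e.1 + 1), (e.2.1 + 1, 0, e.1), p1),
    ((e.2.1, 0, e.1), (e.2.1 + 1, 0, e.1), p2)] e.2.2

lemma triLab_injective (p0 p1 p2 : unitInterval) :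
    Function.Injective (triLab p0 p1 p2) := by
  rintro ⟨a, b, i⟩ ⟨a', b', i'⟩ h
  fin_cases i <;> fin_cases i' <;> simp [triLab] at h ⊢ <;> omega

/-- The edges of `n` rows of the square lattice, in the columns from `a0` to `a0 + c - 1`. -/
noncomputable def sqEdges (a0 : ℤ) (c n : ℕ) : Finset SqE :=
  (Finset.Ico a0 (a0 + c) ×ˢ Finset.Ico (0 : ℤ) n ×ˢ Finset.univ).filter
    fun e => e.2.2 = true → e.1 + 1 < a0 + c

/-- The edges of `n` rows of the triangular lattice, in the trapezoid with `c` vertices at its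
bottom, the leftmost of which is `a0`. -/
noncomputable def triEdges (a0 : ℤ) (c n : ℕ) : Finset TriE :=
  (Finset.Ico a0 (a0 + c) ×ˢ Finset.Ico (0 : ℤ) n ×ˢ Finset.univ).filter
    fun e => e.1 + e.2.1 + 1 < a0 + c

lemma nodup_sum_singleton {α : Type} {f : ℕ → α} (hf : Function.Injective f) (k : ℕ) :
    (∑ i ∈ Finset.range k, ({f i} : Multiset α)).Nodup := by
  have : ∑ i ∈ Finset.range k, ({f i} : Multiset α) = (Finset.range k).val.map f := by
    rw [← Multiset.sum_map_singleton ((Finset.range k).val.map f), Multiset.map_map]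
    rfl
  rw [this]
  exact (Finset.range k).nodup.map hf

lemma nodup_below_replicate_false (t s : ℤ) (c n : ℕ) :
    (below p0 p1 p2 a0 (List.replicate n false) t s c).Nodup := by
  induction n generalizing s with
  | zero => simp [below]
  | succ n ih =>
    rw [List.replicate_succ, below, Multiset.nodup_add, Multiset.nodup_add]
    refine ⟨⟨?_, ?_, ?_⟩, ih _, ?_⟩
    · exact nodup_sum_singleton (fun i j h => by simpa [vx] using h) _
    · exact nodup_sum_singleton (fun i j h => by simpa [vx] using h) _
    · rw [Multiset.disjoint_left]
      intro e h1 h2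
      obtain ⟨-, -, h3⟩ := mem_horiz h1
      obtain ⟨-, -, h4⟩ := mem_sqRow h2
      omega
    · rw [Multiset.disjoint_left]
      intro e h1 h2
      have h3 := mem_strip (mem_strip_of_mem_below h2)
      rcases Multiset.mem_add.1 h1 with h1 | h1
      · obtain ⟨⟨-, h4⟩, -⟩ := mem_horiz h1
        omega
      · obtain ⟨⟨-, h4⟩, -⟩ := mem_sqRow h1
        omega

lemma exists_sqLab_of_mem_below {s : ℤ} {c n : ℕ} {e : WEdge MixV}
    (h : e ∈ below p0 p1 p2 a0 (List.replicate n false) 0 s c) :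
    ∃ x : SqE, sqLab p0 x = e ∧ (a0 ≤ x.1 ∧ x.1 < a0 + c) ∧ (s ≤ x.2.1 ∧ x.2.1 < s + n) ∧
      (x.2.2 = true → x.1 + 1 < a0 + c) := by
  induction n generalizing s with
  | zero => simp [below] at h
  | succ n ih =>
    rw [List.replicate_succ, below, Multiset.mem_add, Multiset.mem_add] at h
    rcases h with (h | h) | h
    · simp only [horiz, Multiset.mem_sum, Multiset.mem_singleton, Finset.mem_range] at h
      obtain ⟨i, hi, rfl⟩ := h
      refine ⟨(a0 + i, s, true), by simp [sqLab, vx, add_assoc], ?_⟩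
      push_cast
      omega
    · simp only [sqRow, Multiset.mem_sum, Multiset.mem_singleton, Finset.mem_range] at h
      obtain ⟨i, hi, rfl⟩ := h
      refine ⟨(a0 + i, s, false), by simp [sqLab, vx], ?_⟩
      push_cast
      simp
      omega
    · obtain ⟨x, hx, h1, h2, h3⟩ := ih h
      exact ⟨x, hx, h1, by push_cast; omega, h3⟩

lemma below_le_map_sqLab (c n : ℕ) :
    below p0 p1 p2 a0 (List.replicate n false) 0 0 c ≤ (sqEdges a0 c n).val.map (sqLab p0) := by
  rw [Multiset.le_iff_subset (nodup_below_replicate_false _ _ _ _)]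
  intro e he
  obtain ⟨x, rfl, h1, h2, h3⟩ := exists_sqLab_of_mem_below he
  refine Multiset.mem_map_of_mem _ ?_
  simp only [sqEdges, Finset.mem_val, Finset.mem_filter, Finset.mem_product, Finset.mem_Ico,
    Finset.mem_univ, and_true]
  exact ⟨⟨h1, by simpa using h2⟩, h3⟩

lemma triLab_mem_below {x : TriE} {t : ℤ} {c n : ℕ} (h1 : t ≤ x.2.1) (h2 : x.2.1 < t + n)
    (h3 : a0 ≤ x.1) (h4 : x.1 + (x.2.1 - t) + 1 < a0 + c) :
    triLab p0 p1 p2 x ∈ below p0 p1 p2 a0 (List.replicate n true) t 0 c := by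
  induction n generalizing t c with
  | zero => simp at h2; omega
  | succ n ih =>
    rw [List.replicate_succ, below, Multiset.mem_add, Multiset.mem_add]
    rcases h1.eq_or_lt with rfl | h1
    · left
      obtain ⟨a, b, j⟩ := x
      obtain ⟨i, rfl⟩ : ∃ i : ℕ, a = a0 + i := ⟨(a - a0).toNat, by simp at h3; omega⟩
      have hi : i < c - 1 := by simp at h4; omega
      fin_cases j
      · left
        simp only [horiz, Multiset.mem_sum, Multiset.mem_singleton, Finset.mem_range]
        exact ⟨i, hi, by simp [triLab, vx, add_assoc]⟩
      · right
        simp only [triRow, Multiset.mem_sum, Multiset.mem_add, Multiset.mem_singleton,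
          Finset.mem_range]
        exact ⟨i, hi, Or.inl (by simp [triLab, vx, add_assoc])⟩
      · right
        simp only [triRow, Multiset.mem_sum, Multiset.mem_add, Multiset.mem_singleton,
          Finset.mem_range]
        exact ⟨i, hi, Or.inr (by simp [triLab, vx])⟩
    · right
      refine ih (by omega) (by push_cast at h2; omega) ?_
      omega

lemma map_triLab_le_below (c n : ℕ) :
    (triEdges a0 c n).val.map (triLab p0 p1 p2) ≤
      below p0 p1 p2 a0 (List.replicate n true) 0 0 c := by
  rw [Multiset.le_iff_subset ((triEdges a0 c n).nodup.map (triLab_injective p0 p1 p2))]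
  intro e he
  obtain ⟨x, hx, rfl⟩ := Multiset.mem_map.1 he
  simp only [triEdges, Finset.mem_val, Finset.mem_filter, Finset.mem_product, Finset.mem_Ico,
    Finset.mem_univ, and_true] at hx
  exact triLab_mem_below hx.1.2.1 (by omega) hx.1.1.1 (by omega)

/-- The comparison of the triangular and square lattices, for connections in finite domains. -/
lemma measure_linked_tri_le_measure_linked_sq (hk : kappaT p0 p1 p2 = 0)
    {PT : Measure (Config TriE)} (hPT : IsBernoulliProduct (triInt p0 p1 p2) PT)
    {PS : Measure (Config SqE)} (hPS : IsBernoulliProduct (sqInt p0 (1 - p0)) PS)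
    (c : ℕ) {n : ℕ} (hn : 0 < n) :
    PT {ω | Linked (level 0 0) (level n 0) (openGen (triLab p0 p1 p2) (triEdges a0 c n) ω)} ≤
      PS {ω | Linked (level 0 0) (level 0 n) (openGen (sqLab p0) (sqEdges a0 c n) ω)} := by
  rw [measure_linked_openGen hPT, measure_linked_openGen hPS]
  · refine ENNReal.ofReal_le_ofReal ?_
    calc _ ≤ _ := expect_le_expect_of_le (map_triLab_le_below c n) (ind_mono _ _) ⊥
      _ ≤ _ := expect_below_replicate_le hk hn c
      _ ≤ _ := expect_le_expect_of_le (below_le_map_sqLab c n) (ind_mono _ _) ⊥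
  · intro e
    unfold sqInt sqLab
    split_ifs <;> simp
  · rintro ⟨a, b, i⟩
    fin_cases i <;> simp [triInt, triLab]

end Mix

/-! ### Crossings of the stretched square lattice -/

/-- A setoid whose classes are the path components of `F`, pulled back by `φ`. -/
def joinedSetoid {V : Type} (φ : V → Pt) (F : Set Pt) : Setoid V where
  r x y := x = y ∨ JoinedIn F (φ x) (φ y)
  iseqv :=
    { refl := fun x => Or.inl rfl
      symm := by
        rintro x y (rfl | h)
        · exact Or.inl rfl
        · exact Or.inr h.symm
      trans := by
        rintro x y z (rfl | h) (rfl | h')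
        · exact Or.inl rfl
        · exact Or.inr h'
        · exact Or.inr h
        · exact Or.inr (h.trans h') }

namespace Mix

/-- The embedding of the square part of a mixed strip in the plane. -/
noncomputable def sqEmb (v : MixV) : Pt := (Real.sqrt 3 * (v.2.2 : ℝ), (v.2.1 : ℝ))

lemma sqStretch_ends (p0 : unitInterval) (e : SqE) :
    sqStretch.ends e = (sqEmb (sqLab p0 e).1, sqEmb (sqLab p0 e).2.1) := by
  simp only [sqStretch, sqLab]
  split_ifs <;> simp [sqEmb]

lemma cv_sqStretch_of_linked {p0 : unitInterval} {a0 : ℤ} {c n : ℕ} {m : ℝ} {ω : Config SqE}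
    (hn : 0 < n) (hl : -m ≤ Real.sqrt 3 * a0) (hr : Real.sqrt 3 * (a0 + c - 1) ≤ m)
    (h : Linked (level 0 0) (level 0 n) (openGen (sqLab p0) (sqEdges a0 c n) ω)) :
    Cv sqStretch m n ω := by
  set B : Set Pt := {z | -m ≤ z.1 ∧ z.1 ≤ m ∧ 0 ≤ z.2 ∧ z.2 ≤ n} with hB
  have hconv : Convex ℝ B := by
    have : B = Icc ((-m, 0) : Pt) (m, (n : ℝ)) := by
      ext z
      simp only [hB, mem_ofPred_eq, mem_Icc, Prod.le_def]
      tauto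
    rw [this]
    exact convex_Icc _ _
  have h3 : 0 ≤ Real.sqrt 3 := Real.sqrt_nonneg 3
  have hmem : ∀ v : MixV, a0 ≤ v.2.2 → v.2.2 < a0 + c → 0 ≤ v.2.1 → v.2.1 ≤ n →
      sqEmb v ∈ B := by
    intro v h1 h2 h4 h5
    have h1' : (a0 : ℝ) ≤ v.2.2 := by exact_mod_cast h1
    have h2' : (v.2.2 : ℝ) ≤ a0 + c - 1 := by
      have : v.2.2 ≤ a0 + c - 1 := by omega
      exact_mod_cast this
    refine ⟨hl.trans (by simp only [sqEmb]; gcongr), le_trans (by simp only [sqEmb]; gcongr) hr,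
      ?_, ?_⟩
    · simpa [sqEmb] using h4
    · simp only [sqEmb]
      exact_mod_cast h5
  have hle : openGen (sqLab p0) (sqEdges a0 c n) ω ≤
      joinedSetoid sqEmb (B ∩ openEdgeSet sqStretch ω) := by
    refine openGen_le_iff.2 fun e he ho => Or.inr ?_
    have hsub : segment ℝ (sqEmb (sqLab p0 e).1) (sqEmb (sqLab p0 e).2.1) ⊆
        B ∩ openEdgeSet sqStretch ω := by
      refine subset_inter (hconv.segment_subset ?_ ?_) ?_
      · simp only [sqEdges, Finset.mem_filter, Finset.mem_product, Finset.mem_Ico] at he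
        unfold sqLab
        split_ifs <;> exact hmem _ (by simp; omega) (by simp; omega) (by simp; omega)
          (by simp; omega)
      · simp only [sqEdges, Finset.mem_filter, Finset.mem_product, Finset.mem_Ico] at he
        unfold sqLab
        split_ifs with hh
        · have := he.2 hh
          exact hmem _ (by simp; omega) (by simp; omega) (by simp; omega) (by simp; omega)
        · exact hmem _ (by simp; omega) (by simp; omega) (by simp; omega) (by simp; omega)
      · intro z hz
        refine mem_iUnion₂.2 ⟨e, ho, ?_⟩
        rwa [sqStretch_ends p0]
    exact (JoinedIn.of_segment_subset hsub)
  obtain ⟨u, hu, v, hv, huv⟩ := h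
  rcases hle huv with rfl | hj
  · exact absurd (hu.2.symm.trans hv.2) (by omega)
  · obtain ⟨γ, hγ⟩ := hj
    refine ⟨γ.extend, γ.continuous_extend.continuousOn, ?_, ?_, fun t ht => ?_⟩
    · have h0 := (hγ 0).1
      rw [γ.source] at h0
      rw [γ.extend_zero]
      exact ⟨by simp [sqEmb, hu.2], h0.1, h0.2.1⟩
    · have h1 := (hγ 1).1
      rw [γ.target] at h1
      rw [γ.extend_one]
      exact ⟨by simp [sqEmb, hv.2], h1.1, h1.2.1⟩
    · rw [γ.extend_apply ht]
      exact hγ _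

end Mix

/-! ### Crossings of the triangular lattice -/

/-- The first of the coordinates in which the vertices of the triangular lattice are integral. -/
noncomputable def triU (z : Pt) : ℝ := z.1 / Real.sqrt 3 - z.2 / 3

/-- The second of the coordinates in which the vertices of the triangular lattice are integral. -/
noncomputable def triV (z : Pt) : ℝ := 2 * z.2 / 3

lemma triU_tv (a b : ℤ) : triU (tv a b) = a := by
  have : Real.sqrt 3 ≠ 0 := by positivity
  simp only [triU, tv]
  field_simp
  ring

lemma triV_tv (a b : ℤ) : triV (tv a b) = b := by
  simp only [triV, tv]
  ring

lemma eq_of_triU_of_triV {z w : Pt} (hu : triU z = triU w) (hv : triV z = triV w) : z = w := by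
  have h3 : Real.sqrt 3 ≠ 0 := by positivity
  have h2 : z.2 = w.2 := by
    simp only [triV] at hv
    linarith
  have h1 : z.1 = w.1 := by
    simp only [triU, h2] at hu
    field_simp at hu
    linarith
  exact Prod.ext h1 h2

namespace Mix

/-- The embedding of the triangular part of a mixed strip in the plane. -/
noncomputable def triEmb (v : MixV) : Pt := tv v.2.2 v.1

variable {p0 p1 p2 : unitInterval}

/-- The segment of the plane occupied by an edge of the triangular lattice. -/
noncomputable def triSeg (e : TriE) : Set Pt :=
  segment ℝ (triLattice.ends e).1 (triLattice.ends e).2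

lemma exists_of_mem_triSeg {e : TriE} {z : Pt} (h : z ∈ triSeg e) :
    ∃ θ ∈ Icc (0 : ℝ) 1, triU z = ![e.1 + θ, e.1 + 1 - θ, e.1] e.2.2 ∧
      triV z = ![(e.2.1 : ℝ), e.2.1 + θ, e.2.1 + θ] e.2.2 := by
  obtain ⟨x, θ, hx, hθ, hs, rfl⟩ := h
  obtain rfl : x = 1 - θ := by linarith
  refine ⟨θ, ⟨hθ, by linarith⟩, ?_⟩
  have hU : ∀ z w : Pt, triU ((1 - θ) • z + θ • w) = (1 - θ) * triU z + θ * triU w := by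
    intro z w
    simp only [triU, Prod.fst_add, Prod.snd_add, Prod.smul_fst, Prod.smul_snd, smul_eq_mul]
    ring
  have hV : ∀ z w : Pt, triV ((1 - θ) • z + θ • w) = (1 - θ) * triV z + θ * triV w := by
    intro z w
    simp only [triV, Prod.snd_add, Prod.smul_snd, smul_eq_mul]
    ring
  obtain ⟨a, b, i⟩ := e
  rw [hU, hV]
  fin_cases i <;> simp [triLattice, triU_tv, triV_tv] <;> constructor <;> ring

open Classical in
/-- The triangular lattice edge whose relative interior may contain the point `z`. -/
noncomputable def edgeAt (z : Pt) : TriE :=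
  (⌊triU z⌋, ⌊triV z⌋,
    if Int.fract (triV z) = 0 then 0 else if Int.fract (triU z) = 0 then 2 else 1)

lemma mem_triSeg_cases (p0 p1 p2 : unitInterval) {e : TriE} {z : Pt} (h : z ∈ triSeg e) :
    (z = triEmb (triLab p0 p1 p2 e).1 ∨ z = triEmb (triLab p0 p1 p2 e).2.1) ∨
      e = edgeAt z ∧ ∀ a b, z ≠ tv a b := by
  obtain ⟨θ, ⟨h0, h1⟩, hu, hv⟩ := exists_of_mem_triSeg h
  obtain ⟨a, b, i⟩ := e
  rcases h0.eq_or_lt with rfl | h0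
  · refine Or.inl (Or.inl (eq_of_triU_of_triV ?_ ?_))
    · rw [hu, triEmb, triU_tv]
      fin_cases i <;> simp [triLab]
    · rw [hv, triEmb, triV_tv]
      fin_cases i <;> simp [triLab]
  rcases h1.eq_or_lt with rfl | h1
  · refine Or.inl (Or.inr (eq_of_triU_of_triV ?_ ?_))
    · rw [hu, triEmb, triU_tv]
      fin_cases i <;> simp [triLab]
    · rw [hv, triEmb, triV_tv]
      fin_cases i <;> simp [triLab]
  right
  have fl : ∀ (x : ℝ) (k : ℤ), k < x → x < k + 1 → ⌊x⌋ = k ∧ Int.fract x ≠ 0 := by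
    intro x k hk hk1
    have : ⌊x⌋ = k := Int.floor_eq_iff.2 ⟨hk.le, hk1⟩
    refine ⟨this, ?_⟩
    rw [Int.fract, this]
    linarith
  have key : (a, b, i) = edgeAt z ∧ (Int.fract (triU z) ≠ 0 ∨ Int.fract (triV z) ≠ 0) := by
    unfold edgeAt
    fin_cases i
    · simp only [Fin.zero_eta, Matrix.cons_val_zero] at hu hv
      obtain ⟨f1, f2⟩ := fl (triU z) a (by linarith) (by linarith)
      simp [f1, f2, hv]
    · simp only [Fin.mk_one, Matrix.cons_val_one, Matrix.cons_val_zero] at hu hv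
      obtain ⟨f1, f2⟩ := fl (triU z) a (by linarith) (by linarith)
      obtain ⟨f3, f4⟩ := fl (triV z) b (by linarith) (by linarith)
      simp [f1, f2, f3, f4]
    · simp only [Fin.reduceFinMk, Matrix.cons_val] at hu hv
      obtain ⟨f3, f4⟩ := fl (triV z) b (by linarith) (by linarith)
      simp [hu, f3, f4]
  refine ⟨key.1, ?_⟩
  rintro a' b' rfl
  simp [triU_tv, triV_tv] at key

/-- Two distinct edges of the triangular lattice meet only at a common endpoint. -/
lemma exists_common_endpoint (p0 p1 p2 : unitInterval) {e e' : TriE} (hne : e ≠ e') {z : Pt}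
    (h : z ∈ triSeg e) (h' : z ∈ triSeg e') : ∃ v : MixV, z = triEmb v ∧
      (v = (triLab p0 p1 p2 e).1 ∨ v = (triLab p0 p1 p2 e).2.1) ∧
      (v = (triLab p0 p1 p2 e').1 ∨ v = (triLab p0 p1 p2 e').2.1) := by
  have hinj : ∀ v w : MixV, v.2.1 = 0 → w.2.1 = 0 → triEmb v = triEmb w → v = w := by
    rintro ⟨t, s, a⟩ ⟨t', s', a'⟩ rfl rfl hvw
    have h1 := congrArg triU hvw
    have h2 := congrArg triV hvw
    simp only [triEmb, triU_tv, triV_tv, Int.cast_inj] at h1 h2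
    rw [h1, h2]
  have hs : ∀ e, (triLab p0 p1 p2 e).1.2.1 = 0 ∧ (triLab p0 p1 p2 e).2.1.2.1 = 0 := by
    rintro ⟨a, b, i⟩
    fin_cases i <;> simp [triLab]
  rcases mem_triSeg_cases p0 p1 p2 h with hz | hz <;>
    rcases mem_triSeg_cases p0 p1 p2 h' with hz' | hz'
  · rcases hz with hz | hz
    · refine ⟨_, hz, Or.inl rfl, ?_⟩
      rw [hz] at hz'
      exact hz'.imp (hinj _ _ (hs e).1 (hs e').1) (hinj _ _ (hs e).1 (hs e').2)
    · refine ⟨_, hz, Or.inr rfl, ?_⟩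
      rw [hz] at hz'
      exact hz'.imp (hinj _ _ (hs e).2 (hs e').1) (hinj _ _ (hs e).2 (hs e').2)
  · rcases hz with hz | hz <;> exact absurd hz (hz'.2 _ _)
  · rcases hz' with hz' | hz' <;> exact absurd hz' (hz.2 _ _)
  · exact absurd (hz.1.trans hz'.1.symm) hne

lemma isClosed_triSeg (e : TriE) : IsClosed (triSeg e) := by
  unfold triSeg
  rw [segment_eq_image_lineMap]
  exact (isCompact_Icc.image AffineMap.lineMap_continuous).isClosed

lemma finite_setOf_triSeg_inter {B : Set Pt} (hB : IsCompact B) :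
    {e | (triSeg e ∩ B).Nonempty}.Finite := by
  obtain ⟨K, hK⟩ : ∃ K, ∀ z ∈ B, ‖triU z‖ ≤ K :=
    hB.exists_bound_of_continuousOn (by unfold triU; fun_prop)
  obtain ⟨K', hK'⟩ : ∃ K, ∀ z ∈ B, ‖triV z‖ ≤ K :=
    hB.exists_bound_of_continuousOn (by unfold triV; fun_prop)
  refine ((Set.finite_Icc (⌊-K⌋ - 1) ⌈K⌉).prod ((Set.finite_Icc (⌊-K'⌋ - 1) ⌈K'⌉).prod
    (Set.finite_univ (α := Fin 3)))).subset ?_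
  rintro ⟨a, b, i⟩ ⟨z, hz, hzB⟩
  obtain ⟨θ, ⟨h0, h1⟩, hu, hv⟩ := exists_of_mem_triSeg hz
  obtain ⟨hu1, hu2⟩ := abs_le.1 (hK z hzB)
  obtain ⟨hv1, hv2⟩ := abs_le.1 (hK' z hzB)
  have h : ((a : ℝ) ≤ K ∧ -K - 1 ≤ a) ∧ ((b : ℝ) ≤ K' ∧ -K' - 1 ≤ b) := by
    fin_cases i <;> simp at hu hv <;> refine ⟨⟨?_, ?_⟩, ?_, ?_⟩ <;> linarith
  have hint : ∀ (k : ℤ) (x : ℝ), (k : ℝ) ≤ x ∧ -x - 1 ≤ k → k ∈ Icc (⌊-x⌋ - 1) ⌈x⌉ := by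
    rintro k x ⟨hk, hk'⟩
    refine ⟨?_, Int.cast_le.1 (hk.trans (Int.le_ceil x))⟩
    have : (⌊-x⌋ : ℝ) - 1 ≤ k := by linarith [Int.floor_le (-x)]
    exact_mod_cast this
  exact ⟨hint a K h.1, hint b K' h.2, mem_univ _⟩

lemma linked_of_cv_triLattice {a0 : ℤ} {c n : ℕ} {m : ℝ} {ω : Config TriE} (hn : 0 < n)
    (hdom : ∀ a b : ℤ, 0 ≤ b → b ≤ n → -m ≤ (tv a b).1 → (tv a b).1 ≤ m →
      a0 ≤ a ∧ a + b < a0 + c)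
    (h : Cv triLattice m (2 * n) ω) :
    Linked (level 0 0) (level n 0) (openGen (triLab p0 p1 p2) (triEdges a0 c n) ω) := by
  by_contra hcon
  set B : Set Pt := {z | -m ≤ z.1 ∧ z.1 ≤ m ∧ 0 ≤ z.2 ∧ z.2 ≤ 2 * n} with hB
  have hBc : IsCompact B := by
    have : B = Icc ((-m, 0) : Pt) (m, 2 * (n : ℝ)) := by
      ext z
      simp only [hB, mem_ofPred_eq, mem_Icc, Prod.le_def]
      tauto
    rw [this]
    exact isCompact_Icc
  set r : MixV → Prop := fun v => ∃ u ∈ level 0 0,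
    openGen (triLab p0 p1 p2) (triEdges a0 c n) ω u v with hr
  have hrn : ∀ v, r v → ¬ (v.1 = n ∧ v.2.1 = 0) := by
    rintro v ⟨u, hu, huv⟩ hv
    exact hcon ⟨u, hu, v, hv, huv⟩
  have hB0 : ∀ v, triEmb v ∈ B → 0 ≤ v.1 := by
    rintro v ⟨-, -, h1, -⟩
    simp only [triEmb, tv] at h1
    have : (0 : ℝ) ≤ v.1 := by linarith
    exact_mod_cast this
  set lab := triLab p0 p1 p2 with hlab
  set good : TriE → Prop := fun e => (e.2.2 = 0 ∧ e.2.1 = 0) ∨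
    ∃ v, (v = (lab e).1 ∨ v = (lab e).2.1) ∧ triEmb v ∈ B ∧ v.1 < n ∧ r v with hgood
  have hstep : ∀ e, ω e = true → good e → ∀ v, (v = (lab e).1 ∨ v = (lab e).2.1) →
      triEmb v ∈ B → v.1 < n ∧ r v := by
    intro e he hge v hv hvB
    rcases hge with ⟨h2, h1⟩ | ⟨w, hw, hwB, hwn, hrw⟩
    · have hv0 : v ∈ level 0 0 := by
        obtain ⟨a, b, i⟩ := e
        obtain rfl : i = 0 := h2
        obtain rfl : b = 0 := h1
        rcases hv with rfl | rfl <;> exact ⟨rfl, rfl⟩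
      exact ⟨by rw [hv0.1]; exact_mod_cast hn, v, hv0, Setoid.refl' _ v⟩
    · have key : triEmb (lab e).1 ∈ B → triEmb (lab e).2.1 ∈ B →
          ((lab e).1.1 < n ∨ (lab e).2.1.1 < n) → e ∈ triEdges a0 c n ∧
          ((lab e).1.1 ≤ n ∧ (lab e).1.2.1 = 0) ∧ ((lab e).2.1.1 ≤ n ∧ (lab e).2.1.2.1 = 0) := by
        intro hB1 hB2 hlt
        have k1 := hB0 _ hB1
        have k2 := hB0 _ hB2
        have hle : (lab e).1.1 ≤ n ∧ (lab e).2.1.1 ≤ n := by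
          obtain ⟨a, b, i⟩ := e
          fin_cases i <;> simp [hlab, triLab] at hlt ⊢ <;> omega
        have d1 := hdom _ _ k1 hle.1 hB1.1 hB1.2.1
        have d2 := hdom _ _ k2 hle.2 hB2.1 hB2.2.1
        obtain ⟨a, b, i⟩ := e
        simp only [triEdges, Finset.mem_filter, Finset.mem_product, Finset.mem_Ico,
          Finset.mem_univ, and_true]
        fin_cases i <;> simp [hlab, triLab] at hlt k1 k2 d1 d2 hle ⊢ <;> omega
      by_cases hvw : v = w
      · exact hvw ▸ ⟨hwn, hrw⟩
      have hrel := openGen_le_iff.1 (le_refl (openGen lab (triEdges a0 c n) ω)) e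
      obtain ⟨u, hu, huw⟩ := hrw
      rcases hv with rfl | rfl <;> rcases hw with rfl | rfl
      · exact absurd rfl hvw
      · obtain ⟨k1, k2, k3⟩ := key hvB hwB (Or.inr hwn)
        have hrv : r (lab e).1 := ⟨u, hu, Setoid.trans' _ huw (Setoid.symm' _ (hrel k1 he))⟩
        exact ⟨k2.1.lt_of_ne fun h => hrn _ hrv ⟨h, k2.2⟩, hrv⟩
      · obtain ⟨k1, k2, k3⟩ := key hwB hvB (Or.inl hwn)
        have hrv : r (lab e).2.1 := ⟨u, hu, Setoid.trans' _ huw (hrel k1 he)⟩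
        exact ⟨k3.1.lt_of_ne fun h => hrn _ hrv ⟨h, k3.2⟩, hrv⟩
      · exact absurd rfl hvw
  have hgood0 : ∀ e z, z ∈ triSeg e → z ∈ B → z.2 = 0 → good e := by
    intro e z hz hzB hz0
    have hv0 : triV z = 0 := by simp [triV, hz0]
    have hend : ∀ v, (v = (lab e).1 ∨ v = (lab e).2.1) → z = triEmb v → good e := by
      rintro v hv rfl
      have hv1 : v.1 = 0 := by
        rw [triEmb, triV_tv] at hv0
        exact_mod_cast hv0
      have hv2 : v.2.1 = 0 := by
        obtain ⟨a, b, i⟩ := e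
        rcases hv with rfl | rfl <;> fin_cases i <;> rfl
      exact Or.inr ⟨v, hv, hzB, by rw [hv1]; exact_mod_cast hn, v, ⟨hv1, hv2⟩, Setoid.refl' _ v⟩
    rcases mem_triSeg_cases p0 p1 p2 hz with (h | h) | ⟨rfl, -⟩
    · exact hend _ (Or.inl rfl) h
    · exact hend _ (Or.inr rfl) h
    · exact Or.inl (by simp [edgeAt, hv0])
  have hgood1 : ∀ e z, z ∈ triSeg e → z.2 = 2 * n → ¬ good e := by
    intro e z hz hzn hge
    have hv0 : (n : ℝ) < triV z := by
      have : (0 : ℝ) < n := by exact_mod_cast hn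
      simp only [triV, hzn]
      linarith
    obtain ⟨θ, ⟨h0, h1⟩, -, hv⟩ := exists_of_mem_triSeg hz
    rcases hge with ⟨h2, h3⟩ | ⟨w, hw, -, hwn, -⟩
    · simp only [h2, h3, Int.cast_zero, Matrix.cons_val_zero] at hv
      have : (0 : ℝ) ≤ n := n.cast_nonneg
      linarith
    · have hwn' : (w.1 : ℝ) + 1 ≤ n := by exact_mod_cast hwn
      obtain ⟨a, b, i⟩ := e
      rcases hw with rfl | rfl <;> fin_cases i <;> simp [hlab, triLab] at hv hwn' <;> linarith
  have hfin := finite_setOf_triSeg_inter hBc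
  set G : Set Pt := ⋃ e ∈ {e | (triSeg e ∩ B).Nonempty} ∩ {e | ω e = true ∧ good e}, triSeg e
    with hG
  set H : Set Pt := ⋃ e ∈ {e | (triSeg e ∩ B).Nonempty} ∩ {e | ω e = true ∧ ¬ good e}, triSeg e
    with hH
  have hGc : IsClosed G := (hfin.inter_of_left _).isClosed_biUnion fun e _ => isClosed_triSeg e
  have hHc : IsClosed H := (hfin.inter_of_left _).isClosed_biUnion fun e _ => isClosed_triSeg e
  obtain ⟨γ, hγ, h0, h1, hmem⟩ := h
  have hedge : ∀ t ∈ Icc (0 : ℝ) 1, ∃ e, ω e = true ∧ γ t ∈ triSeg e ∧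
      (triSeg e ∩ B).Nonempty := by
    intro t ht
    obtain ⟨e, he, hte⟩ := mem_iUnion₂.1 (hmem t ht).2
    exact ⟨e, he, hte, _, hte, (hmem t ht).1⟩
  obtain ⟨z, ⟨t, ht, rfl⟩, hzG, hzH⟩ := isPreconnected_closed_iff.1
    (isPreconnected_Icc.image γ hγ) G H hGc hHc (by
      rintro _ ⟨t, ht, rfl⟩
      obtain ⟨e, he, hte, hB⟩ := hedge t ht
      by_cases hg : good e
      · exact Or.inl (mem_biUnion ⟨hB, he, hg⟩ hte)
      · exact Or.inr (mem_biUnion ⟨hB, he, hg⟩ hte)) (by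
      obtain ⟨e, he, hte, hB⟩ := hedge 0 ⟨le_rfl, zero_le_one⟩
      refine ⟨_, mem_image_of_mem γ ⟨le_rfl, zero_le_one⟩, mem_biUnion ⟨hB, he, ?_⟩ hte⟩
      exact hgood0 e _ hte (hmem 0 ⟨le_rfl, zero_le_one⟩).1 h0.1) (by
      obtain ⟨e, he, hte, hB⟩ := hedge 1 ⟨zero_le_one, le_rfl⟩
      exact ⟨_, mem_image_of_mem γ ⟨zero_le_one, le_rfl⟩,
        mem_biUnion ⟨hB, he, hgood1 e _ hte h1.1⟩ hte⟩)
  obtain ⟨e, ⟨-, he, hge⟩, hze⟩ := mem_iUnion₂.1 hzG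
  obtain ⟨e', ⟨-, he', hge'⟩, hze'⟩ := mem_iUnion₂.1 hzH
  obtain ⟨v, hv, hve, hve'⟩ := exists_common_endpoint p0 p1 p2
    (fun hee => hge' (hee ▸ hge) : e ≠ e') hze hze'
  have hvB : triEmb v ∈ B := hv ▸ (hmem t ht).1
  exact hge' (Or.inr ⟨v, hve', hvB, hstep e he hge v hve hvB⟩)

end Mix

/-- For self-dual `p = (p0,p1,p2) ∈ [0,1)³`, every `α > 0` and
every even `N ∈ 2ℕ`:
`P^□_{(p0,1-p0)}[C_v((α + 1/2)N, N/2)] ≥ P^△_p[C_v(αN, N)]`. -/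
theorem vertical_crossing_triangle_to_square (p0 p1 p2 : ℝ)
    (h0 : p0 ∈ Set.Ico (0 : ℝ) 1) (h1 : p1 ∈ Set.Ico (0 : ℝ) 1)
    (h2 : p2 ∈ Set.Ico (0 : ℝ) 1) (hsd : kappaT p0 p1 p2 = 0)
    (PT : Measure (Config TriE)) (hPT : IsBernoulliProduct (triInt p0 p1 p2) PT)
    (PS : Measure (Config SqE)) (hPS : IsBernoulliProduct (sqInt p0 (1 - p0)) PS)
    (α : ℝ) (hα : 0 < α) (N : ℕ) (hNe : Even N) (hN : 0 < N) :
    PT {ω | Cv triLattice (α * N) N ω} ≤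
      PS {ω | Cv sqStretch ((α + 1 / 2) * N) ((N : ℝ) / 2) ω} := by
  lift p0 to unitInterval using ⟨h0.1, h0.2.le⟩
  lift p1 to unitInterval using ⟨h1.1, h1.2.le⟩
  lift p2 to unitInterval using ⟨h2.1, h2.2.le⟩
  obtain ⟨n, rfl⟩ := hNe
  have hn : 0 < n := by omega
  have hN2 : ((n + n : ℕ) : ℝ) = 2 * n := by push_cast; ring
  rw [hN2, mul_div_cancel_left₀ _ (two_ne_zero' ℝ)]
  obtain ⟨m, hm⟩ : ∃ m, m = α * (2 * n) := ⟨_, rfl⟩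
  have hm0 : 0 < m := by rw [hm]; positivity
  have hmn : (α + 1 / 2) * (2 * n) = m + n := by rw [hm]; ring
  rw [hmn, ← hm]
  have hn0 : (0 : ℝ) < n := by exact_mod_cast hn
  have h3 : 0 < Real.sqrt 3 := by positivity
  have h3' : Real.sqrt 3 ≤ 2 := Real.sqrt_le_iff.2 (by norm_num)
  obtain ⟨x, hx⟩ : ∃ x, x = m / Real.sqrt 3 + n / 2 := ⟨_, rfl⟩
  have hx0 : 0 < x := by rw [hx]; positivity
  have hsx : Real.sqrt 3 * x ≤ m + n := by
    have : Real.sqrt 3 * x = m + Real.sqrt 3 * n / 2 := by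
      rw [hx]
      field_simp
    rw [this]
    nlinarith
  obtain ⟨a0, ha0⟩ : ∃ a0, a0 = ⌈-x⌉ := ⟨_, rfl⟩
  have hle : a0 ≤ ⌊x⌋ := by
    have h4 : a0 ≤ 0 := by
      rw [ha0]
      exact Int.ceil_le.2 (by simpa using hx0.le)
    exact h4.trans (Int.floor_nonneg.2 hx0.le)
  obtain ⟨c, hc⟩ : ∃ c : ℕ, a0 + c = ⌊x⌋ + 1 := ⟨(⌊x⌋ + 1 - a0).toNat, by omega⟩
  have hcR : (a0 : ℝ) + c - 1 = ⌊x⌋ := by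
    have : ((a0 + c : ℤ) : ℝ) = ((⌊x⌋ + 1 : ℤ) : ℝ) := by rw [hc]
    push_cast at this
    linarith
  have hdom : ∀ a b : ℤ, 0 ≤ b → b ≤ n → -m ≤ (tv a b).1 → (tv a b).1 ≤ m →
      a0 ≤ a ∧ a + b < a0 + c := by
    intro a b hb0 hbn hl hr
    have hb0' : (0 : ℝ) ≤ b := by exact_mod_cast hb0
    have hbn' : (b : ℝ) ≤ n := by exact_mod_cast hbn
    simp only [tv] at hl hr
    have hr' : (a : ℝ) + b / 2 ≤ m / Real.sqrt 3 := by
      rwa [le_div_iff₀ h3, mul_comm]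
    have hl' : -(m / Real.sqrt 3) ≤ (a : ℝ) + b / 2 := by
      rwa [← neg_div, div_le_iff₀ h3, mul_comm]
    constructor
    · rw [ha0]
      exact Int.ceil_le.2 (by rw [hx]; linarith)
    · rw [hc, Int.lt_add_one_iff, Int.le_floor]
      push_cast
      rw [hx]
      linarith
  calc PT {ω | Cv triLattice m (2 * n) ω}
      ≤ PT {ω | Linked (Mix.level 0 0) (Mix.level n 0)
          (openGen (Mix.triLab p0 p1 p2) (Mix.triEdges a0 c n) ω)} :=
        measure_mono fun ω hω => Mix.linked_of_cv_triLattice hn hdom hω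
    _ ≤ PS {ω | Linked (Mix.level 0 0) (Mix.level 0 n)
          (openGen (Mix.sqLab p0) (Mix.sqEdges a0 c n) ω)} :=
        Mix.measure_linked_tri_le_measure_linked_sq hsd hPT hPS c hn
    _ ≤ PS {ω | Cv sqStretch (m + n) n ω} := by
        refine measure_mono fun ω hω => Mix.cv_sqStretch_of_linked hn ?_ ?_ hω
        · have : -x ≤ a0 := by
            rw [ha0]
            exact Int.le_ceil _
          nlinarith
        · rw [hcR]
          exact (mul_le_mul_of_nonneg_left (Int.floor_le x) h3.le).trans hsx

end Perc
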